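/- arXiv:2402.15669 — 3 statements merged into one kernel-verified Lean document; each statement's English description precedes it below -/
import Mathlib

section
/- Let T be a tree with diameter k. Then π(T) ≥ π(P_{k+1}), where P_{k+1} is the path on k+1 vertices, with equality if and only if T is isomorphic to the path P_{k+1}, or k = 2 and T is a star. -/
open scoped Classical

/-- Permanent of the Laplacian matrix of `G` (over `ℝ`). -/
noncomputable def permL {V : Type*} [Fintype V] (G : SimpleGraph V) : ℝ :=
  (G.lapMatrix ℝ).permanent

/-- Product of the degrees of all vertices of `G`. -/
noncomputable def PD {V : Type*} [Fintype V] (G : SimpleGraph V) : ℝ :=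
  ∏ v, (G.degree v : ℝ)

/-- The Laplacian ratio `π(G) = per L(G) / PD(G)`. -/
noncomputable def lapRatio {V : Type*} [Fintype V] (G : SimpleGraph V) : ℝ :=
  permL G / PD G

/-- A star: a tree with at most one vertex of degree exceeding `1`. -/
def IsStar {V : Type*} [Fintype V] (G : SimpleGraph V) : Prop :=
  G.IsTree ∧ {v : V | 1 < G.degree v}.Subsingleton


/-- The contribution of a permutation to the Laplacian ratio, with all signs made positive. -/
noncomputable def permWeight {V : Type*} [Fintype V] (G : SimpleGraph V) (σ : Equiv.Perm V) : ℝ :=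
  ∏ i, if σ i = i then 1 else if G.Adj i (σ i) then (G.degree i : ℝ)⁻¹ else 0

section PermWeight

variable {V : Type*} [Fintype V] {G : SimpleGraph V}

lemma permWeight_nonneg (G : SimpleGraph V) (σ : Equiv.Perm V) : 0 ≤ permWeight G σ :=
  Finset.prod_nonneg fun i _ => by split_ifs <;> positivity

lemma permWeight_one (G : SimpleGraph V) : permWeight G 1 = 1 := by simp [permWeight]

lemma eq_or_adj_of_permWeight_ne_zero {σ : Equiv.Perm V} (h : permWeight G σ ≠ 0) (i : V) :
    σ i = i ∨ G.Adj i (σ i) := by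
  by_contra! hc
  exact h (Finset.prod_eq_zero (Finset.mem_univ i) (by simp [hc.1, hc.2]))

lemma lapRatio_eq_sum_permWeight (hG : G.Colorable 2) (hd : ∀ v, 0 < G.degree v) :
    lapRatio G = ∑ σ : Equiv.Perm V, permWeight G σ := by
  obtain ⟨C⟩ := hG
  set s : V → ℝ := fun v => (-1) ^ (C v).val with hs
  have hss : ∀ v, s v * s v = 1 := fun v => by simp [hs, ← mul_pow]
  have hadj : ∀ v w, G.Adj v w → s v * s w = -1 := by
    intro v w h
    have hne := C.valid h
    simp only [hs]
    generalize C v = a at *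
    generalize C w = b at *
    fin_cases a <;> fin_cases b <;> simp at *
  have hPD : PD G ≠ 0 :=
    Finset.prod_ne_zero_iff.2 fun v _ => by exact_mod_cast (hd v).ne'
  have hentry : ∀ i j : V, s i * s j * G.lapMatrix ℝ i j =
      G.degree i * (if j = i then 1 else if G.Adj i j then (G.degree i : ℝ)⁻¹ else 0) := by
    intro i j
    have hi : (G.degree i : ℝ) ≠ 0 := by exact_mod_cast (hd i).ne'
    by_cases hij : j = i
    · subst hij
      simp [SimpleGraph.lapMatrix, SimpleGraph.degMatrix, hss]
    · by_cases ha : G.Adj i j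
      · simp [SimpleGraph.lapMatrix, SimpleGraph.degMatrix, hij, ha, Ne.symm hij, hadj i j ha, hi]
      · simp [SimpleGraph.lapMatrix, SimpleGraph.degMatrix, hij, ha, Ne.symm hij]
  rw [lapRatio, div_eq_iff hPD, permL, ← Matrix.permanent_transpose, Matrix.permanent,
    Finset.sum_mul]
  refine Finset.sum_congr rfl fun σ _ => ?_
  have hsign : ∏ i, s i * s (σ i) = 1 := by
    rw [Finset.prod_mul_distrib, Equiv.prod_comp σ s, ← Finset.prod_mul_distrib]
    simp [hss]
  rw [← one_mul (∏ i, _), ← hsign, ← Finset.prod_mul_distrib, permWeight, PD,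
    ← Finset.prod_mul_distrib]
  refine Finset.prod_congr rfl fun i _ => ?_
  rw [Matrix.transpose_apply, hentry, mul_comm]

lemma apply_apply_eq_of_permWeight_ne_zero (hG : G.IsAcyclic) {σ : Equiv.Perm V}
    (h : permWeight G σ ≠ 0) {u : V} (hu : σ u ≠ u) : σ (σ u) = u := by
  have hadj := (eq_or_adj_of_permWeight_ne_zero h u).resolve_left hu
  set c := σ u with hc
  have hbr := SimpleGraph.isAcyclic_iff_forall_adj_isBridge.1 hG hadj
  rw [SimpleGraph.isBridge_iff] at hbr
  by_contra hne
  let S : Finset V := {x | (G.deleteEdges {s(u, c)}).Reachable c x}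
  have huS : u ∉ S := by simpa [S] using fun h => hbr h.symm
  have hcS : c ∈ S := by simp [S]
  have hmap : ∀ x ∈ S, σ x ∈ S := by
    intro x hx
    rcases eq_or_adj_of_permWeight_ne_zero h x with hx' | hx'
    · rwa [hx']
    · by_cases he : s(x, σ x) = s(u, c)
      · rcases Sym2.eq_iff.1 he with ⟨rfl, -⟩ | ⟨rfl, h2⟩
        · exact absurd hx huS
        · exact absurd h2 hne
      · simp only [S, Finset.mem_filter, Finset.mem_univ, true_and] at hx ⊢
        exact hx.trans (SimpleGraph.Adj.reachable (by simpa [hx'] using he))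
  have himg : S.image σ = S :=
    Finset.eq_of_subset_of_card_le (Finset.image_subset_iff.2 hmap)
      (Finset.card_image_of_injective _ σ.injective).ge
  rw [← himg] at hcS
  obtain ⟨x, hx, hxc⟩ := Finset.mem_image.1 hcS
  exact huS (σ.injective (hxc.trans hc) ▸ hx)

lemma permWeight_eq_of_swap {σ : Equiv.Perm V} {u c : V} (hadj : G.Adj u c) (hu : σ u = u)
    (hc : σ c = c) :
    permWeight G (Equiv.swap u c * σ) =
      (G.degree u : ℝ)⁻¹ * (G.degree c : ℝ)⁻¹ * permWeight G σ := by
  have hne := hadj.ne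
  have hcu : c ∈ Finset.univ.erase u := by simp [hne.symm]
  simp only [permWeight]
  rw [← Finset.mul_prod_erase _ _ (Finset.mem_univ u), ← Finset.mul_prod_erase _ _ hcu,
    ← Finset.mul_prod_erase Finset.univ (fun i => if σ i = i then (1 : ℝ) else _)
      (Finset.mem_univ u), ← Finset.mul_prod_erase (Finset.univ.erase u) (fun i => if σ i = i then
      (1 : ℝ) else _) hcu]
  have hrest : ∀ i ∈ (Finset.univ.erase u).erase c, (Equiv.swap u c * σ) i = σ i := by
    intro i hi
    simp only [Finset.mem_erase, Finset.mem_univ, and_true] at hi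
    exact Equiv.swap_apply_of_ne_of_ne (fun h => hi.2 (σ.injective (h.trans hu.symm)))
      (fun h => hi.1 (σ.injective (h.trans hc.symm)))
  rw [Finset.prod_congr rfl fun i hi => by rw [hrest i hi]]
  simp [hu, hc, hne, hne.symm, hadj, hadj.symm, mul_assoc]

lemma sum_permWeight_apply_eq (hG : G.IsAcyclic) {u c : V} (hadj : G.Adj u c) :
    ∑ σ : Equiv.Perm V with σ u = c, permWeight G σ =
      (G.degree u : ℝ)⁻¹ * (G.degree c : ℝ)⁻¹ *
        ∑ σ : Equiv.Perm V with σ u = u ∧ σ c = c, permWeight G σ := by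
  have hsub : ∑ σ : Equiv.Perm V with σ u = c, permWeight G σ =
      ∑ σ : Equiv.Perm V with σ u = c ∧ σ c = u, permWeight G σ := by
    refine (Finset.sum_subset ?_ ?_).symm
    · intro σ
      simp +contextual
    · intro σ h1 h2
      simp only [Finset.mem_filter, Finset.mem_univ, true_and] at h1 h2
      by_contra h
      have h3 := apply_apply_eq_of_permWeight_ne_zero hG h (u := u) (h1 ▸ hadj.ne')
      exact h2 ⟨h1, by rwa [h1] at h3⟩
  rw [hsub, Finset.mul_sum]
  refine Finset.sum_bij' (fun σ _ => Equiv.swap u c * σ) (fun σ _ => Equiv.swap u c * σ)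
    ?_ ?_ ?_ ?_ ?_
  · intro σ h
    simp only [Finset.mem_filter, Finset.mem_univ, true_and] at h
    simp [h.1, h.2]
  · intro σ h
    simp only [Finset.mem_filter, Finset.mem_univ, true_and] at h
    simp [h.1, h.2]
  · intro σ _
    simp
  · intro σ _
    simp
  · intro σ h
    simp only [Finset.mem_filter, Finset.mem_univ, true_and] at h
    rw [← permWeight_eq_of_swap hadj (by simp [h.1]) (by simp [h.2])]
    simp

lemma sum_permWeight_apply_ne (hG : G.IsAcyclic) (u : V) :
    ∑ σ : Equiv.Perm V with σ u ≠ u, permWeight G σ =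
      (G.degree u : ℝ)⁻¹ * ∑ c ∈ G.neighborFinset u, (G.degree c : ℝ)⁻¹ *
        ∑ σ : Equiv.Perm V with σ u = u ∧ σ c = c, permWeight G σ := by
  rw [Finset.mul_sum]
  calc _ = ∑ σ : Equiv.Perm V with σ u ∈ G.neighborFinset u, permWeight G σ := by
        refine (Finset.sum_subset ?_ ?_).symm
        · intro σ
          simp only [Finset.mem_filter, Finset.mem_univ, true_and, SimpleGraph.mem_neighborFinset]
          exact fun h => h.ne'
        · intro σ h1 h2
          simp only [Finset.mem_filter, Finset.mem_univ, true_and,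
            SimpleGraph.mem_neighborFinset] at h1 h2
          by_contra h
          exact h2 ((eq_or_adj_of_permWeight_ne_zero h u).resolve_left h1)
    _ = ∑ c ∈ G.neighborFinset u, ∑ σ : Equiv.Perm V with σ u = c, permWeight G σ := by
        rw [← Finset.sum_fiberwise_of_maps_to (t := G.neighborFinset u) (g := fun σ => σ u)]
        · refine Finset.sum_congr rfl fun c hc => Finset.sum_congr ?_ fun _ _ => rfl
          ext σ
          simp only [Finset.mem_filter, Finset.mem_univ, true_and]
          exact ⟨fun h => h.2, fun h => ⟨h ▸ hc, h⟩⟩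
        · intro σ h
          simpa using h
    _ = _ := by
        refine Finset.sum_congr rfl fun c hc => ?_
        rw [sum_permWeight_apply_eq hG (by simpa using hc), mul_assoc]

lemma sum_permWeight_fix_fix_le (u c : V) :
    ∑ σ : Equiv.Perm V with σ u = u ∧ σ c = c, permWeight G σ ≤
      ∑ σ : Equiv.Perm V with σ u = u, permWeight G σ :=
  Finset.sum_le_sum_of_subset_of_nonneg (fun σ => by simp +contextual)
    fun σ _ _ => permWeight_nonneg G σ

lemma sum_permWeight_fix_pos (u : V) :
    0 < ∑ σ : Equiv.Perm V with σ u = u, permWeight G σ :=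
  Finset.sum_pos' (fun σ _ => permWeight_nonneg G σ) ⟨1, by simp, by simp [permWeight_one]⟩

lemma sum_permWeight_fix_eq_mul {u : V} (hu : 0 < G.degree u) :
    ∑ σ : Equiv.Perm V with σ u = u, permWeight G σ = (G.degree u : ℝ)⁻¹ *
      ∑ _c ∈ G.neighborFinset u, ∑ σ : Equiv.Perm V with σ u = u, permWeight G σ := by
  rw [Finset.sum_const, SimpleGraph.card_neighborFinset_eq_degree, nsmul_eq_mul,
    inv_mul_cancel_left₀ (by exact_mod_cast hu.ne')]

lemma inv_degree_mul_sum_le (u c : V) :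
    (G.degree c : ℝ)⁻¹ * ∑ σ : Equiv.Perm V with σ u = u ∧ σ c = c, permWeight G σ ≤
      ∑ σ : Equiv.Perm V with σ u = u, permWeight G σ := by
  refine (mul_le_of_le_one_left ?_ (Nat.cast_inv_le_one _)).trans (sum_permWeight_fix_fix_le u c)
  exact Finset.sum_nonneg fun σ _ => permWeight_nonneg G σ

lemma sum_permWeight_move_le (hG : G.IsAcyclic) {u : V} (hu : 0 < G.degree u) :
    ∑ σ : Equiv.Perm V with σ u ≠ u, permWeight G σ ≤
      ∑ σ : Equiv.Perm V with σ u = u, permWeight G σ := by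
  rw [sum_permWeight_apply_ne hG, sum_permWeight_fix_eq_mul hu]
  gcongr with c hc
  exact inv_degree_mul_sum_le u c

lemma sum_permWeight_move_lt (hG : G.IsAcyclic) {u c : V} (hadj : G.Adj u c)
    (hc : 1 < G.degree c) :
    ∑ σ : Equiv.Perm V with σ u ≠ u, permWeight G σ <
      ∑ σ : Equiv.Perm V with σ u = u, permWeight G σ := by
  have hu : 0 < G.degree u := (G.degree_pos_iff_exists_adj u).2 ⟨c, hadj⟩
  rw [sum_permWeight_apply_ne hG, sum_permWeight_fix_eq_mul hu]
  refine mul_lt_mul_of_pos_left (Finset.sum_lt_sum (fun c _ => inv_degree_mul_sum_le u c)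
    ⟨c, by simpa using hadj, ?_⟩) (by positivity)
  refine (mul_le_mul_of_nonneg_left (sum_permWeight_fix_fix_le u c) (by positivity)).trans_lt ?_
  exact mul_lt_of_lt_one_left (sum_permWeight_fix_pos u)
    (inv_lt_one_of_one_lt₀ (by exact_mod_cast hc))

lemma sum_permWeight_move_eq (hG : G.IsAcyclic) {u : V} (hu : 0 < G.degree u)
    (h : ∀ c, G.Adj u c → G.degree c = 1) :
    ∑ σ : Equiv.Perm V with σ u ≠ u, permWeight G σ =
      ∑ σ : Equiv.Perm V with σ u = u, permWeight G σ := by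
  rw [sum_permWeight_apply_ne hG, sum_permWeight_fix_eq_mul hu]
  congr 1
  refine Finset.sum_congr rfl fun c hc => ?_
  have hadj : G.Adj u c := by simpa using hc
  rw [h c hadj, Nat.cast_one, inv_one, one_mul]
  refine Finset.sum_subset (fun σ => by simp +contextual) fun σ h1 h2 => ?_
  simp only [Finset.mem_filter, Finset.mem_univ, true_and] at h1 h2
  by_contra h0
  refine h2 ⟨h1, (eq_or_adj_of_permWeight_ne_zero h0 c).resolve_right fun hcσ => ?_⟩
  obtain ⟨w, -, hw⟩ := (G.degree_eq_one_iff_existsUnique_adj).1 (h c hadj)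
  have : σ c = σ u := by rw [h1, hw _ hcσ, hw _ hadj.symm]
  exact hadj.ne' (σ.injective this)

end PermWeight

section LeafRemoval

variable {V : Type*} [Fintype V] {G : SimpleGraph V} {l : V}

lemma sum_filter_fix_eq_sum_ofSubtype (l : V) (f : Equiv.Perm V → ℝ) :
    ∑ σ : Equiv.Perm V with σ l = l, f σ =
      ∑ τ : Equiv.Perm ({l}ᶜ : Set V), f (Equiv.Perm.ofSubtype τ) := by
  rw [Finset.sum_subtype (p := fun σ : Equiv.Perm V => ∀ a, a ∉ ({l}ᶜ : Set V) → σ a = a) _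
    (by simp)]
  exact (Fintype.sum_equiv (Equiv.Perm.subtypeEquivSubtypePerm (· ∈ ({l}ᶜ : Set V))) _ _
    fun _ => rfl).symm

lemma degree_add_of_induce_compl_eq {H : SimpleGraph ({l}ᶜ : Set V)} (hH : G.induce {l}ᶜ = H)
    (x : ({l}ᶜ : Set V)) :
    H.degree x + (if G.Adj l x then 1 else 0) = G.degree x := by
  have h : (H.neighborFinset x).map (Function.Embedding.subtype _) =
      (G.neighborFinset x).erase l := by
    ext y
    simp [← hH, and_comm]
  rw [← SimpleGraph.card_neighborFinset_eq_degree, ← SimpleGraph.card_neighborFinset_eq_degree,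
    ← Finset.card_map (Function.Embedding.subtype _), h]
  split_ifs with ha
  · exact Finset.card_erase_add_one (by simpa using ha.symm)
  · rw [add_zero, Finset.erase_eq_of_notMem (by simpa using fun h => ha h.symm)]

lemma permWeight_ofSubtype {H : SimpleGraph ({l}ᶜ : Set V)} (hH : G.induce {l}ᶜ = H)
    (τ : Equiv.Perm ({l}ᶜ : Set V)) :
    permWeight G (Equiv.Perm.ofSubtype τ) =
      ∏ x, if τ x = x then 1 else if H.Adj x (τ x) then (G.degree x : ℝ)⁻¹ else 0 := by
  have hl : (Equiv.Perm.ofSubtype τ) l = l :=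
    Equiv.Perm.ofSubtype_apply_of_not_mem τ (by simp)
  rw [permWeight, ← Finset.mul_prod_erase _ _ (Finset.mem_univ l), if_pos hl, one_mul,
    Finset.prod_subtype (p := (· ∈ ({l}ᶜ : Set V))) _ (by simp)]
  refine Finset.prod_congr rfl fun x _ => ?_
  simp [← hH, Subtype.ext_iff]

/-- Removing a leaf `l` with neighbour `u` of degree at least two lowers the permanent sum by an
amount governed by the balance at `u` in the smaller graph. -/
lemma degree_mul_sum_permWeight_sub (hG : G.IsAcyclic) {H : SimpleGraph ({l}ᶜ : Set V)}
    (hH : G.induce {l}ᶜ = H) (hl : G.degree l = 1) {u : ({l}ᶜ : Set V)} (hadj : G.Adj l u)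
    (hu : 1 < G.degree u) :
    G.degree u * (∑ σ : Equiv.Perm V, permWeight G σ -
        ∑ τ : Equiv.Perm ({l}ᶜ : Set V), permWeight H τ) =
      ∑ τ : Equiv.Perm ({l}ᶜ : Set V) with τ u = u, permWeight H τ -
        ∑ τ : Equiv.Perm ({l}ᶜ : Set V) with τ u ≠ u, permWeight H τ := by
  obtain ⟨w, -, hw⟩ := (G.degree_eq_one_iff_existsUnique_adj).1 hl
  have hnb : ∀ x, G.Adj l x ↔ x = (u : V) := fun x =>
    ⟨fun h => (hw x h).trans (hw u hadj).symm, fun h => h ▸ hadj⟩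
  have hdegu : H.degree u + 1 = G.degree u := by
    simpa [hadj] using degree_add_of_induce_compl_eq hH u
  have hdeg : ∀ x, x ≠ u → H.degree x = G.degree x := by
    intro x hx
    have := degree_add_of_induce_compl_eq hH x
    rwa [if_neg fun h => hx (Subtype.ext ((hnb _).1 h)), add_zero] at this
  have hfix : ∀ τ : Equiv.Perm ({l}ᶜ : Set V), τ u = u →
      permWeight G (Equiv.Perm.ofSubtype τ) = permWeight H τ := by
    intro τ hτ
    rw [permWeight_ofSubtype hH, permWeight]
    refine Finset.prod_congr rfl fun x _ => ?_
    by_cases hx : x = u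
    · simp [hx, hτ]
    · rw [hdeg x hx]
      congr
  have hmove : ∀ τ : Equiv.Perm ({l}ᶜ : Set V), τ u ≠ u →
      G.degree u * permWeight G (Equiv.Perm.ofSubtype τ) = H.degree u * permWeight H τ := by
    intro τ hτ
    have hd' : (H.degree u : ℝ) ≠ 0 := by
      have : 0 < H.degree u := by omega
      exact_mod_cast this.ne'
    have hd : (G.degree u : ℝ) ≠ 0 := by exact_mod_cast (by omega)
    rw [permWeight_ofSubtype hH, permWeight, ← Finset.mul_prod_erase _ _ (Finset.mem_univ u),
      ← Finset.mul_prod_erase _ _ (Finset.mem_univ u), ← mul_assoc, ← mul_assoc]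
    congr 1
    · rw [if_neg hτ, if_neg hτ]
      split_ifs <;> simp [hd, hd']
    · refine Finset.prod_congr rfl fun x hx => ?_
      rw [hdeg x (Finset.ne_of_mem_erase hx)]
      congr
  have happ : ∀ τ : Equiv.Perm ({l}ᶜ : Set V),
      Equiv.Perm.ofSubtype τ (u : V) = (u : V) ↔ τ u = u := by
    intro τ
    rw [Equiv.Perm.ofSubtype_apply_of_mem τ u.2, Subtype.ext_iff]
  have hF : ∑ σ : Equiv.Perm V with σ l = l ∧ σ u = (u : V), permWeight G σ =
      ∑ τ : Equiv.Perm ({l}ᶜ : Set V) with τ u = u, permWeight H τ := by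
    rw [← Finset.filter_filter, Finset.sum_filter, sum_filter_fix_eq_sum_ofSubtype,
      Finset.sum_filter]
    refine Finset.sum_congr rfl fun τ _ => ?_
    simp only [happ]
    split_ifs with h
    · exact hfix τ h
    · rfl
  have hsplit : ∑ σ : Equiv.Perm V, permWeight G σ =
      ∑ σ : Equiv.Perm V with σ l = l, permWeight G σ + (G.degree u : ℝ)⁻¹ *
        ∑ τ : Equiv.Perm ({l}ᶜ : Set V) with τ u = u, permWeight H τ := by
    have hN : G.neighborFinset l = {(u : V)} := by
      ext x
      simp [hnb]
    rw [← Finset.sum_filter_add_sum_filter_not Finset.univ (fun σ : Equiv.Perm V => σ l = l)]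
    congr 1
    rw [sum_permWeight_apply_ne hG l, hN, Finset.sum_singleton, hF, hl]
    simp
  have hB : G.degree u * ∑ σ : Equiv.Perm V with σ l = l, permWeight G σ =
      G.degree u * ∑ τ : Equiv.Perm ({l}ᶜ : Set V) with τ u = u, permWeight H τ +
      H.degree u * ∑ τ : Equiv.Perm ({l}ᶜ : Set V) with τ u ≠ u, permWeight H τ := by
    rw [sum_filter_fix_eq_sum_ofSubtype,
      ← Finset.sum_filter_add_sum_filter_not Finset.univ
        (fun τ : Equiv.Perm ({l}ᶜ : Set V) => τ u = u), mul_add]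
    congr 1
    · rw [Finset.sum_congr rfl fun τ hτ => hfix τ (Finset.mem_filter.1 hτ).2]
    · rw [Finset.mul_sum, Finset.mul_sum]
      exact Finset.sum_congr rfl fun τ hτ => hmove τ (Finset.mem_filter.1 hτ).2
  have hd : (G.degree u : ℝ) ≠ 0 := by exact_mod_cast (by omega)
  have hdu : (G.degree u : ℝ) = H.degree u + 1 := by exact_mod_cast hdegu.symm
  rw [hsplit, mul_sub, mul_add, hB, mul_inv_cancel_left₀ hd,
    ← Finset.sum_filter_add_sum_filter_not Finset.univ
      (fun τ : Equiv.Perm ({l}ᶜ : Set V) => τ u = u) (fun τ => permWeight H τ), hdu]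
  ring

end LeafRemoval

section Tree

open SimpleGraph

variable {V : Type*} {G : SimpleGraph V}

lemma SimpleGraph.IsTree.length_eq_dist (hG : G.IsTree) {u v : V} {p : G.Walk u v}
    (hp : p.IsPath) : p.length = G.dist u v := by
  obtain ⟨q, hq, hql⟩ := hG.connected.exists_path_of_dist u v
  rw [(hG.existsUnique_path u v).unique hp hq, hql]

lemma SimpleGraph.IsTree.eq_of_dist_eq_add_one (hG : G.IsTree) {r x y z : V} (hy : G.Adj y x)
    (hz : G.Adj z x) (hyd : G.dist r x = G.dist r y + 1) (hzd : G.dist r x = G.dist r z + 1) :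
    y = z := by
  obtain ⟨p, hp⟩ := hG.connected.exists_walk_length_eq_dist r y
  obtain ⟨q, hq⟩ := hG.connected.exists_walk_length_eq_dist r z
  have hp' := (p.concat hy).isPath_of_length_eq_dist (by rw [Walk.length_concat, hp, hyd])
  have hq' := (q.concat hz).isPath_of_length_eq_dist (by rw [Walk.length_concat, hq, hzd])
  have := congrArg Walk.penultimate ((hG.existsUnique_path r x).unique hp' hq')
  simpa only [Walk.penultimate_concat] using this

/-- In a tree with pairwise distances at most two there is no path with three edges. -/
lemma SimpleGraph.IsTree.not_adj_adj_adj (hG : G.IsTree) (hd : ∀ x y, G.dist x y ≤ 2)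
    {x c u l : V} (hxc : G.Adj x c) (hcu : G.Adj c u) (hul : G.Adj u l) (hxu : x ≠ u) :
    c = l := by
  have h1 : G.dist x c = 1 := dist_eq_one_iff_adj.2 hxc
  have h2 := hG.dist_eq_dist_add_one_of_adj x hcu
  have h3 := hG.dist_eq_dist_add_one_of_adj x hul
  have h4 : G.dist x u ≠ 0 := fun h => hxu (hG.connected.dist_eq_zero_iff.1 h)
  have h5 := hd x l
  exact hG.eq_of_dist_eq_add_one (r := x) hcu hul.symm (by omega) (by omega)

lemma SimpleGraph.IsTree.exists_leaf_notMem_support [Fintype V] (hG : G.IsTree) {v w : V}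
    {p : G.Walk v w} (hp : p.IsPath) (hne : ∃ x, x ∉ p.support) :
    ∃ l, l ∉ p.support ∧ G.degree l = 1 := by
  obtain ⟨l, hl, hmax⟩ := Finset.exists_max_image ({x | x ∉ p.support} : Finset V) (G.dist v)
    (by simpa [Finset.Nonempty] using hne)
  simp only [Finset.mem_filter, Finset.mem_univ, true_and] at hl hmax
  refine ⟨l, hl, ?_⟩
  have hcloser : ∀ y, G.Adj y l → G.dist v l = G.dist v y + 1 := by
    intro y hy
    refine (hG.dist_eq_dist_add_one_of_adj v hy).symm.resolve_right fun h => ?_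
    have hys : y ∈ p.support := by
      by_contra hc
      have := hmax y hc
      omega
    obtain ⟨q, hq⟩ := hG.connected.exists_walk_length_eq_dist v l
    have hq' := (q.concat hy.symm).isPath_of_length_eq_dist (by rw [Walk.length_concat, hq, h])
    have heq := (hG.existsUnique_path v y).unique hq' (hp.takeUntil hys)
    apply hl
    apply p.support_takeUntil_subset_support hys
    rw [← heq]
    exact q.support_subset_support_concat _ q.end_mem_support
  have : Nontrivial V := ⟨l, v, fun h => hl (h ▸ p.start_mem_support)⟩
  obtain ⟨y, hy⟩ := hG.connected.preconnected.exists_adj_of_nontrivial l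
  exact degree_eq_one_iff_existsUnique_adj.2 ⟨y, hy, fun z hz =>
    hG.eq_of_dist_eq_add_one hz.symm hy.symm (hcloser z hz.symm) (hcloser y hy.symm)⟩

lemma SimpleGraph.IsTree.induce_compl_leaf [Fintype V] (hG : G.IsTree) {l : V}
    (hl : G.degree l = 1) : (G.induce {l}ᶜ).IsTree :=
  ⟨hG.connected.induce_compl_singleton_of_degree_eq_one hl, hG.isAcyclic.induce _⟩

lemma SimpleGraph.IsTree.dist_induce_compl_leaf [Fintype V] (hG : G.IsTree) {l : V}
    (hl : G.degree l = 1) (x y : ({l}ᶜ : Set V)) :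
    (G.induce {l}ᶜ).dist x y = G.dist x y := by
  obtain ⟨p, hp, hpl⟩ := (hG.induce_compl_leaf hl).connected.exists_path_of_dist x y
  have hmap := Walk.IsPath.map (f := (Embedding.induce {l}ᶜ).toHom) Subtype.val_injective hp
  rw [← hpl, ← Walk.length_map (Embedding.induce {l}ᶜ).toHom]
  exact hG.length_eq_dist hmap

/-- A geodesic walk through all vertices identifies the graph with a path graph. -/
lemma SimpleGraph.IsTree.nonempty_iso_pathGraph (hG : G.IsTree) {v w : V} {p : G.Walk v w}
    (hp : p.IsPath) (hall : ∀ x, x ∈ p.support) :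
    Nonempty (G ≃g pathGraph (p.length + 1)) := by
  have hbij : Function.Bijective (fun i : Fin (p.length + 1) => p.getVert i) := by
    refine ⟨fun i j h => Fin.ext (hp.getVert_injOn (by simp; omega) (by simp; omega) h),
      fun x => ?_⟩
    obtain ⟨n, hn, hle⟩ := Walk.mem_support_iff_exists_getVert.1 (hall x)
    exact ⟨⟨n, by omega⟩, hn⟩
  have hdist : ∀ i, i ≤ p.length → G.dist v (p.getVert i) = i := by
    intro i hi
    rw [← hG.length_eq_dist (hp.take i), Walk.take_length]
    omega
  refine ⟨(RelIso.symm ⟨Equiv.ofBijective _ hbij, ?_⟩)⟩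
  intro i j
  simp only [Equiv.ofBijective_apply, pathGraph_adj]
  constructor
  · intro h
    have := hG.dist_eq_dist_add_one_of_adj v h
    rw [hdist i (by omega), hdist j (by omega)] at this
    omega
  · rintro (h | h)
    · rw [← h]
      exact p.adj_getVert_succ (by omega)
    · rw [← h]
      exact (p.adj_getVert_succ (by omega)).symm

end Tree

section LapRatio

open SimpleGraph

lemma SimpleGraph.Iso.lapRatio_eq {V W : Type*} [Fintype V] [Fintype W] {G : SimpleGraph V}
    {H : SimpleGraph W} (e : G ≃g H) : lapRatio G = lapRatio H := by
  have hentry : ∀ i j, H.lapMatrix ℝ (e i) (e j) = G.lapMatrix ℝ i j := by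
    intro i j
    by_cases hij : i = j
    · subst hij
      simp [lapMatrix, degMatrix, e.degree_eq]
    · simp [lapMatrix, degMatrix, hij, e.map_adj_iff]
  rw [lapRatio, lapRatio]
  congr 1
  · refine Fintype.sum_equiv e.toEquiv.permCongr _ _ fun σ => ?_
    refine Fintype.prod_equiv e.toEquiv _ _ fun i => ?_
    rw [Equiv.permCongr_apply, Equiv.symm_apply_apply]
    exact (hentry _ _).symm
  · refine Fintype.prod_equiv e.toEquiv _ _ fun i => ?_
    exact congrArg _ (e.degree_eq i).symm

lemma SimpleGraph.IsTree.lapRatio_eq_sum_permWeight {V : Type*} [Fintype V] [Nontrivial V]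
    {G : SimpleGraph V} (hG : G.IsTree) :
    lapRatio G = ∑ σ : Equiv.Perm V, permWeight G σ :=
  _root_.lapRatio_eq_sum_permWeight hG.colorable_two fun v =>
    (G.degree_pos_iff_exists_adj v).2 (hG.connected.preconnected.exists_adj_of_nontrivial v)

variable {V : Type*} [Fintype V] {G : SimpleGraph V}

lemma SimpleGraph.IsTree.lapRatio_induce_compl_leaf (hG : G.IsTree) {l : V}
    [Nontrivial ({l}ᶜ : Set V)] {H : SimpleGraph ({l}ᶜ : Set V)} (hH : G.induce {l}ᶜ = H)
    (hl : G.degree l = 1) {u : ({l}ᶜ : Set V)} (hadj : G.Adj l u) :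
    lapRatio H ≤ lapRatio G ∧
      ((∃ c, H.Adj u c ∧ 1 < H.degree c) → lapRatio H < lapRatio G) ∧
      ((∀ c, H.Adj u c → H.degree c = 1) → lapRatio G = lapRatio H) := by
  have hHt : H.IsTree := hH ▸ hG.induce_compl_leaf hl
  have : Nontrivial V := Subtype.val_injective.nontrivial (α := ({l}ᶜ : Set V))
  have hHu : 0 < H.degree u :=
    (H.degree_pos_iff_exists_adj u).2 (hHt.connected.preconnected.exists_adj_of_nontrivial u)
  have hGu : 1 < G.degree u := by
    have := degree_add_of_induce_compl_eq hH u
    rw [if_pos hadj] at this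
    omega
  have key := degree_mul_sum_permWeight_sub hG.isAcyclic hH hl hadj hGu
  have hpos : (0 : ℝ) < G.degree u := by exact_mod_cast (by omega)
  rw [hG.lapRatio_eq_sum_permWeight, hHt.lapRatio_eq_sum_permWeight]
  refine ⟨?_, ?_, ?_⟩
  · have h := sum_permWeight_move_le hHt.isAcyclic hHu
    rw [← sub_nonneg]
    refine nonneg_of_mul_nonneg_right (a := (G.degree u : ℝ)) ?_ hpos
    refine (sub_nonneg.2 h).trans_eq (Eq.trans ?_ (key.symm.trans ?_)) <;> congr!
  · rintro ⟨c, hc, hdc⟩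
    have h := sum_permWeight_move_lt hHt.isAcyclic hc hdc
    rw [← sub_pos]
    refine pos_of_mul_pos_right (a := (G.degree u : ℝ)) ?_ hpos.le
    refine (sub_pos.2 h).trans_eq (Eq.trans ?_ (key.symm.trans ?_)) <;> congr!
  · intro hc
    have h := sum_permWeight_move_eq hHt.isAcyclic hHu hc
    rw [← sub_eq_zero]
    refine (mul_eq_zero.1 (Eq.trans ?_ (sub_eq_zero.2 h.symm))).resolve_left hpos.ne'
    refine (Eq.trans ?_ (key.trans ?_)) <;> congr!

lemma SimpleGraph.Connected.dist_le_one_of_degree_eq_one (hG : G.Connected) {u : V}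
    (h : ∀ c, G.Adj u c → G.degree c = 1) (x : V) : G.dist u x ≤ 1 := by
  have hclosed : ∀ a (w : G.Walk a x), (a = u ∨ G.Adj u a) → (x = u ∨ G.Adj u x) := by
    intro a w
    induction w with
    | nil => exact id
    | cons hab _ ih =>
      refine fun ha => ih ?_
      rcases ha with rfl | ha
      · exact Or.inr hab
      · obtain ⟨z, -, hz⟩ := degree_eq_one_iff_existsUnique_adj.1 (h _ ha)
        exact Or.inl ((hz _ hab).trans (hz _ ha.symm).symm)
  obtain ⟨w⟩ := hG.preconnected u x
  rcases hclosed u w (Or.inl rfl) with rfl | hx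
  · simp
  · exact (dist_eq_one_iff_adj.2 hx).le

/-- A tree with all distances at most two is a star. -/
lemma SimpleGraph.IsTree.isStar (hG : G.IsTree) (hd : ∀ x y, G.dist x y ≤ 2) : IsStar G := by
  refine ⟨hG, fun v hv w hw => ?_⟩
  by_contra hne
  have hother : ∀ x y, 1 < G.degree x → ∃ z, G.Adj x z ∧ z ≠ y := by
    intro x y hx
    rw [← card_neighborFinset_eq_degree] at hx
    obtain ⟨z, hz, hzy⟩ := Finset.exists_mem_ne hx y
    exact ⟨z, by simpa using hz, hzy⟩
  obtain ⟨q, hq⟩ := hG.connected.exists_walk_length_eq_dist v w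
  have hq2 : q.length ≤ 2 := hq ▸ hd v w
  match q with
  | .nil => exact hne rfl
  | .cons h .nil =>
    obtain ⟨v', hv', hvw⟩ := hother v w hv
    obtain ⟨w', hw', hwv⟩ := hother w v hw
    exact hwv (hG.not_adj_adj_adj hd hv'.symm h hw' hvw).symm
  | .cons h (.cons h' .nil) =>
    obtain ⟨w', hw', hwm⟩ := hother w _ hw
    exact hwm (hG.not_adj_adj_adj hd h h' hw' hne).symm
  | .cons _ (.cons _ (.cons _ _)) =>
    simp at hq2

lemma SimpleGraph.IsTree.lapRatio_pathGraph_le (k : ℕ) (hk : 1 ≤ k) (n : ℕ) :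
    ∀ {V : Type*} [Fintype V] {G : SimpleGraph V}, Fintype.card V = n → G.IsTree →
      (∃ v w, G.dist v w = k) → (∀ v w, G.dist v w ≤ k) →
      lapRatio (pathGraph (k + 1)) ≤ lapRatio G ∧
      (k ≤ 2 → lapRatio G = lapRatio (pathGraph (k + 1))) ∧
      (3 ≤ k → Nonempty (G ≃g pathGraph (k + 1)) ∨
        lapRatio (pathGraph (k + 1)) < lapRatio G) := by
  induction n with
  | zero =>
    rintro V _ G hcard - ⟨v, -⟩
    exact absurd hcard (Fintype.card_pos_iff.2 ⟨v⟩).ne'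
  | succ n ih =>
    rintro V _ G hcard hG ⟨v, w, hvw⟩ hd
    obtain ⟨p, hp, hpk⟩ := hG.connected.exists_path_of_dist v w
    by_cases hall : ∀ x, x ∈ p.support
    · have hiso := hG.nonempty_iso_pathGraph hp hall
      rw [hpk, hvw] at hiso
      have heq := hiso.some.lapRatio_eq
      exact ⟨heq.ge, fun _ => heq, fun _ => Or.inl hiso⟩
    push Not at hall
    obtain ⟨l, hlp, hl⟩ := hG.exists_leaf_notMem_support hp hall
    obtain ⟨H, hH⟩ : ∃ H, G.induce {l}ᶜ = H := ⟨_, rfl⟩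
    have hHt : H.IsTree := hH ▸ hG.induce_compl_leaf hl
    have hHd : ∀ x y : ({l}ᶜ : Set V), H.dist x y = G.dist x y :=
      hH ▸ hG.dist_induce_compl_leaf hl
    let v' : ({l}ᶜ : Set V) := ⟨v, fun h => hlp (h ▸ p.start_mem_support)⟩
    let w' : ({l}ᶜ : Set V) := ⟨w, fun h => hlp (h ▸ p.end_mem_support)⟩
    have hvw' : H.dist v' w' = k := (hHd v' w').trans hvw
    have : Nontrivial ({l}ᶜ : Set V) := ⟨v', w', fun h => by
      rw [h, dist_self] at hvw'
      omega⟩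
    obtain ⟨u, hadj, -⟩ := degree_eq_one_iff_existsUnique_adj.1 hl
    lift u to ({l}ᶜ : Set V) using hadj.ne'
    obtain ⟨hle, hlt, heq⟩ := hG.lapRatio_induce_compl_leaf hH hl hadj
    have hcardH : Fintype.card ({l}ᶜ : Set V) = n := by
      rw [Fintype.card_compl_set, hcard, Fintype.card_unique, Nat.add_sub_cancel]
    obtain ⟨hH1, hH2, -⟩ := ih hcardH hHt ⟨v', w', hvw'⟩ fun x y => (hHd x y).trans_le (hd x y)
    refine ⟨hH1.trans hle, fun hk2 => (heq fun c hc => ?_).trans (hH2 hk2), fun hk3 =>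
      Or.inr (hH1.trans_lt (hlt ?_))⟩
    · refine degree_eq_one_iff_existsUnique_adj.2 ⟨u, hc.symm, fun x hx => ?_⟩
      by_contra hxu
      subst hH
      exact c.2 (hG.not_adj_adj_adj (fun x y => (hd x y).trans hk2) (x := x) (c := c) (u := u)
        hx.symm hc.symm hadj.symm (fun h => hxu (Subtype.ext h)))
    · by_contra! hc
      have hone : ∀ c, H.Adj u c → H.degree c = 1 := fun c huc =>
        (hc c huc).antisymm ((H.degree_pos_iff_exists_adj c).2 ⟨u, huc.symm⟩)
      have h1 := hHt.connected.dist_le_one_of_degree_eq_one hone v'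
      have h2 := hHt.connected.dist_le_one_of_degree_eq_one hone w'
      have h3 := hHt.connected.dist_triangle (u := v') (v := u) (w := w')
      rw [dist_comm (u := v') (v := u)] at h3
      omega

lemma SimpleGraph.IsTree.nonempty_iso_pathGraph_of_dist_le_one (hG : G.IsTree) {k : ℕ}
    (hk : k ≤ 1) {v w : V} (hvw : G.dist v w = k) (hd : ∀ x y, G.dist x y ≤ k) :
    Nonempty (G ≃g pathGraph (k + 1)) := by
  obtain ⟨p, hp, hpk⟩ := hG.connected.exists_path_of_dist v w
  rw [← hvw, ← hpk]
  refine hG.nonempty_iso_pathGraph hp ?_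
  by_contra! hne
  obtain ⟨l, hlp, hl⟩ := hG.exists_leaf_notMem_support hp hne
  have hadj : ∀ x ∈ p.support, G.dist l x = 1 := by
    intro x hx
    have h0 : G.dist l x ≠ 0 := fun h => hlp (hG.connected.dist_eq_zero_iff.1 h ▸ hx)
    have := hd l x
    omega
  obtain ⟨z, -, hz⟩ := degree_eq_one_iff_existsUnique_adj.1 hl
  have hv := hadj v p.start_mem_support
  have heq : v = w := (hz v (dist_eq_one_iff_adj.1 hv)).trans
    (hz w (dist_eq_one_iff_adj.1 (hadj w p.end_mem_support))).symm
  have := hd l v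
  rw [heq, dist_self] at hvw
  omega

end LapRatio

/-- a tree with diameter `k` has Laplacian ratio at least that of the path
`P_{k+1}`, with equality iff it is the path `P_{k+1}`, or `k = 2` and it is a star. -/
theorem lapRatio_ge_path {V : Type*} [Fintype V] (k : ℕ) (T : SimpleGraph V)
    (hT : T.IsTree) (hdiam : (∃ u v : V, T.dist u v = k) ∧ ∀ u v : V, T.dist u v ≤ k) :
    lapRatio (SimpleGraph.pathGraph (k + 1)) ≤ lapRatio T ∧
    (lapRatio T = lapRatio (SimpleGraph.pathGraph (k + 1)) ↔
      Nonempty (T ≃g SimpleGraph.pathGraph (k + 1)) ∨ (k = 2 ∧ IsStar T)) := by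
  obtain ⟨hex, hd⟩ := hdiam
  by_cases hk : k ≤ 1
  · obtain ⟨u, v, huv⟩ := hex
    have hiso := hT.nonempty_iso_pathGraph_of_dist_le_one hk huv hd
    have heq := hiso.some.lapRatio_eq
    exact ⟨heq.ge, fun _ => Or.inl hiso, fun _ => heq⟩
  obtain ⟨hle, hsmall, hlarge⟩ :=
    SimpleGraph.IsTree.lapRatio_pathGraph_le k (by omega) _ rfl hT hex hd
  refine ⟨hle, fun heq => ?_, ?_⟩
  · by_cases hk2 : k = 2
    · exact Or.inr ⟨hk2, hT.isStar (hk2 ▸ hd)⟩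
    · exact Or.inl ((hlarge (by omega)).resolve_right heq.not_gt)
  · rintro (⟨⟨e⟩⟩ | ⟨hk2, -⟩)
    · exact e.lapRatio_eq
    · exact hsmall hk2.le
end

section
/- Let H be a tree with a distinguished vertex u, let T_r be a star on r ≥ 1 vertices disjoint from H with center v, let G_1 be the tree obtained from the disjoint union of H and T_r by adding the edge uv, and let G_2 be the tree obtained from H by attaching r pendant edges at u. Then π(G_1) ≥ π(G_2). -/
open scoped Classical

/-- The product of the degrees of the two endpoints of an edge `e`. -/
noncomputable def edgeDeg {V : Type*} [Fintype V] (G : SimpleGraph V) (e : Sym2 V) : ℝ :=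
  Sym2.lift ⟨fun a b => (G.degree a : ℝ) * (G.degree b : ℝ), fun _ _ => mul_comm _ _⟩ e

/-- `G₁`: the tree obtained from the disjoint union of `H` and `T` by adding the edge
joining `u ∈ V(H)` to `v ∈ V(T)`. -/
def joinTrees {α β : Type*} (H : SimpleGraph α) (T : SimpleGraph β) (u : α) (v : β) :
    SimpleGraph (α ⊕ β) :=
  (H ⊕g T) ⊔ SimpleGraph.fromEdgeSet {s(Sum.inl u, Sum.inr v)}

/-- `G₂`: the tree obtained from `H` by attaching a pendant edge at `u` for every `b : β`. -/
def attachPendants {α : Type*} (β : Type*) (H : SimpleGraph α) (u : α) :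
    SimpleGraph (α ⊕ β) :=
  (H ⊕g (⊥ : SimpleGraph β)) ⊔
    SimpleGraph.fromEdgeSet {e | ∃ b : β, e = s(Sum.inl u, Sum.inr b)}

namespace Matrix

section CommSemiring

variable {m n R : Type*} [Fintype m] [Fintype n] [DecidableEq m] [DecidableEq n] [CommSemiring R]

theorem permanent_submatrix_equiv_self (e : m ≃ n) (M : Matrix n n R) :
    (M.submatrix e e).permanent = M.permanent := by
  unfold permanent
  refine Fintype.sum_equiv e.permCongr _ _ fun σ => ?_
  refine Fintype.prod_equiv e _ _ fun i => ?_
  simp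

theorem permanent_updateRow_add (M : Matrix n n R) (i : n) (x y : n → R) :
    (M.updateRow i (x + y)).permanent =
      (M.updateRow i x).permanent + (M.updateRow i y).permanent := by
  simp only [permanent, ← Finset.sum_add_distrib]
  refine Finset.sum_congr rfl fun σ _ => ?_
  have key (z : n → R) : ∏ j, M.updateRow i z (σ j) j =
      z (σ.symm i) * ∏ j ∈ Finset.univ.erase (σ.symm i), M (σ j) j := by
    rw [← Finset.mul_prod_erase _ _ (Finset.mem_univ (σ.symm i))]
    congr 1
    · simp
    · refine Finset.prod_congr rfl fun j hj => ?_
      rw [updateRow_ne]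
      rintro rfl
      simp at hj
  rw [key, key, key, Pi.add_apply, add_mul]

theorem permanent_eq_zero_of_row_eq_zero {M : Matrix n n R} (i : n) (h : ∀ j, M i j = 0) :
    M.permanent = 0 :=
  Finset.sum_eq_zero fun σ _ =>
    Finset.prod_eq_zero (Finset.mem_univ (σ.symm i)) (by simp [h])

/-- Swapping the rows of index `i` and `j`. -/
theorem permanent_updateRow_updateRow_comm (M : Matrix n n R) {i j : n} (hij : i ≠ j)
    (x y : n → R) :
    ((M.updateRow i x).updateRow j y).permanent = ((M.updateRow i y).updateRow j x).permanent := by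
  rw [← permanent_permute_cols (Equiv.swap i j)]
  congr 1
  ext a b
  rcases eq_or_ne a i with rfl | hi
  · simp [hij]
  rcases eq_or_ne a j with rfl | hj
  · simp [hij]
  · simp [Equiv.swap_apply_of_ne_of_ne hi hj, hi, hj]

theorem permanent_fromBlocks_zero₂₁ (A : Matrix m m R) (B : Matrix m n R) (D : Matrix n n R) :
    (fromBlocks A B 0 D).permanent = A.permanent * D.permanent := by
  simp only [permanent, Finset.sum_mul_sum, ← Finset.sum_product', Finset.univ_product_univ]
  symm
  refine Finset.sum_of_injOn (fun σ => σ.1.sumCongr σ.2) ?_ (by simp) ?_ ?_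
  · intro σ _ τ _ h
    exact Equiv.Perm.sumCongrHom_injective (a₁ := σ) (a₂ := τ) h
  · intro σ _ hσ
    have h : ¬ Set.MapsTo σ (Set.range Sum.inl) (Set.range Sum.inl) := by
      intro h
      obtain ⟨τ, rfl⟩ := Equiv.Perm.mem_sumCongrHom_range_of_perm_mapsTo_inl h
      exact hσ ⟨τ, by simp, rfl⟩
    simp only [Set.MapsTo, Set.mem_range, forall_exists_index, forall_apply_eq_imp_iff,
      not_forall] at h
    obtain ⟨a, ha⟩ := h
    refine Finset.prod_eq_zero (Finset.mem_univ (Sum.inl a)) ?_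
    rcases hx : σ (Sum.inl a) with b | b
    · exact absurd ⟨b, hx.symm⟩ ha
    · simp
  · intro σ _
    simp [Fintype.prod_sum_type]

theorem permanent_fromBlocks_zero₁₂ (A : Matrix m m R) (C : Matrix n m R) (D : Matrix n n R) :
    (fromBlocks A 0 C D).permanent = A.permanent * D.permanent := by
  rw [← permanent_transpose, fromBlocks_transpose, transpose_zero, permanent_fromBlocks_zero₂₁,
    permanent_transpose, permanent_transpose]

/-- The permanent of two diagonal blocks joined by a single pair of symmetric entries. -/
theorem permanent_fromBlocks_single (X : Matrix m m R) (Y : Matrix n n R) (u : m) (v : n)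
    (c d : R) :
    (fromBlocks X (single u v c) (single v u d) Y).permanent =
      X.permanent * Y.permanent + c * d *
        ((X.updateRow u (Pi.single u 1)).permanent * (Y.updateRow v (Pi.single v 1)).permanent) := by
  set Z := fromBlocks X 0 0 Y with hZ
  have hM : fromBlocks X (single u v c) (single v u d) Y =
      (Z.updateRow (Sum.inl u) ((Sum.elim (X u) 0 : m ⊕ n → R) +
        (Sum.elim 0 (Pi.single v c) : m ⊕ n → R))).updateRow (Sum.inr v)
        ((Sum.elim 0 (Y v) : m ⊕ n → R) + Sum.elim (Pi.single u d) 0) := by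
    ext (i | i) (j | j) <;>
      simp [hZ, updateRow_apply, single_apply, Pi.single_apply] <;> grind
  have h₁ : (Z.updateRow (Sum.inl u) (Sum.elim (X u) 0)).updateRow
      (Sum.inr v) (Sum.elim 0 (Y v)) = Z := by
    ext (i | i) (j | j) <;> simp [hZ, updateRow_apply] <;> grind
  have h₂ : (Z.updateRow (Sum.inl u) (Sum.elim (X u) 0)).updateRow
      (Sum.inr v) (Sum.elim (Pi.single u d) 0) =
        fromBlocks X 0 (single v u d) (Y.updateRow v 0) := by
    ext (i | i) (j | j) <;> simp [hZ, updateRow_apply, single_apply, Pi.single_apply] <;> grind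
  have h₃ : (Z.updateRow (Sum.inl u) ((Sum.elim 0 (Pi.single v c) : m ⊕ n → R))).updateRow
      (Sum.inr v) (Sum.elim 0 (Y v)) =
        fromBlocks (X.updateRow u 0) (single u v c) 0 Y := by
    ext (i | i) (j | j) <;> simp [hZ, updateRow_apply, single_apply, Pi.single_apply] <;> grind
  have h₄ : (Z.updateRow (Sum.inl u) (Sum.elim (Pi.single u d) 0)).updateRow
      (Sum.inr v) (Sum.elim 0 (Pi.single v c)) =
        fromBlocks (X.updateRow u (d • (Pi.single u 1 : m → R))) 0 0
          (Y.updateRow v (c • (Pi.single v 1 : n → R))) := by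
    ext (i | i) (j | j) <;> simp [hZ, updateRow_apply, Pi.single_apply]
  have hne : (Sum.inl u : m ⊕ n) ≠ Sum.inr v := Sum.inl_ne_inr
  rw [hM, permanent_updateRow_add, updateRow_comm _ hne, updateRow_comm _ hne,
    permanent_updateRow_add, permanent_updateRow_add, updateRow_comm _ hne.symm,
    updateRow_comm _ hne.symm, updateRow_comm _ hne.symm, updateRow_comm _ hne.symm, h₁, h₂, h₃,
    permanent_updateRow_updateRow_comm _ hne, h₄, hZ, permanent_fromBlocks_zero₁₂,
    permanent_fromBlocks_zero₁₂, permanent_fromBlocks_zero₁₂, permanent_fromBlocks_zero₂₁,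
    permanent_updateRow_smul, permanent_updateRow_smul,
    permanent_eq_zero_of_row_eq_zero (M := X.updateRow u 0) u (by simp),
    permanent_eq_zero_of_row_eq_zero (M := Y.updateRow v 0) v (by simp)]
  ring

/-- The matrix `X` bordered by an identity block indexed by `n`, where each index in `n` is joined
to `u` by an entry `q` in row `u` and an entry `c` in column `u`. -/
def pendantBlocks (n : Type*) [DecidableEq n] (X : Matrix m m R) (u : m) (q c : R) :
    Matrix (m ⊕ n) (m ⊕ n) R :=
  fromBlocks X (of fun i _ => if i = u then q else 0)
    (of fun _ j => if j = u then c else 0) 1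

theorem permanent_pendantBlocks_zero (X : Matrix m m R) (u : m) (c : R) :
    (pendantBlocks n X u 0 c).permanent = X.permanent := by
  have : (of fun i _ => if i = u then 0 else 0 : Matrix m n R) = 0 := by ext; simp
  rw [pendantBlocks, this, permanent_fromBlocks_zero₁₂, permanent_one, mul_one]

omit [Fintype m] [Fintype n] in
theorem updateRow_pendantBlocks (X : Matrix m m R) (u : m) (q c : R) :
    (pendantBlocks n X u q c).updateRow (Sum.inl u) (Pi.single (Sum.inl u) 1) =
      pendantBlocks n (X.updateRow u (Pi.single u 1)) u 0 c := by
  ext (i | i) (j | j) <;> simp [pendantBlocks, updateRow_apply, Pi.single_apply]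
  grind

theorem permanent_pendantBlocks (X : Matrix m m R) (u : m) (q c : R) :
    (pendantBlocks n X u q c).permanent =
      X.permanent + Fintype.card n * (q * c) * (X.updateRow u (Pi.single u 1)).permanent := by
  classical
  suffices h : ∀ [DecidableEq n], (pendantBlocks n X u q c).permanent =
      X.permanent + Fintype.card n * (q * c) * (X.updateRow u (Pi.single u 1)).permanent from h
  refine Fintype.induction_empty_option
    (P := fun n _ => ∀ [DecidableEq n], (pendantBlocks n X u q c).permanent =
      X.permanent + Fintype.card n * (q * c) * (X.updateRow u (Pi.single u 1)).permanent)
    ?_ ?_ ?_ n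
  · intro α β _ e h _
    let := Fintype.ofEquiv β e.symm
    let : DecidableEq α := Classical.decEq α
    have h := h
    rw [Fintype.card_congr e] at h
    rw [← h, ← permanent_submatrix_equiv_self ((Equiv.refl m).sumCongr e)]
    congr 1
    ext (i | i) (j | j) <;> simp [pendantBlocks, one_apply]
  · intro _
    rw [← permanent_submatrix_equiv_self (Equiv.sumEmpty m PEmpty).symm]
    simp only [Fintype.card_pempty, Nat.cast_zero, zero_mul, add_zero]
    congr 1
  · intro β _ h _
    let : DecidableEq β := Classical.decEq β
    let e : (m ⊕ β) ⊕ Unit ≃ m ⊕ Option β :=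
      (Equiv.sumAssoc m β Unit).trans ((Equiv.refl m).sumCongr (Equiv.optionEquivSumPUnit β).symm)
    have he : (pendantBlocks (Option β) X u q c).submatrix e e =
        fromBlocks (pendantBlocks β X u q c) (single (Sum.inl u) () q)
          (single () (Sum.inl u) c) 1 := by
      ext ((i | i) | i) ((j | j) | j) <;>
        simp [pendantBlocks, e, single_apply, one_apply, eq_comm]
    rw [← permanent_submatrix_equiv_self e, he, permanent_fromBlocks_single, h,
      updateRow_pendantBlocks, permanent_pendantBlocks_zero]
    simp
    ring

end CommSemiring

/-- The permanent is invariant under conjugation by a diagonal sign matrix, so it is nonnegative as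
soon as one such conjugate has nonnegative entries. -/
theorem permanent_nonneg_of_signs {n : Type*} [Fintype n] [DecidableEq n] {M : Matrix n n ℝ}
    (s : n → ℝ) (hs : ∀ i, s i * s i = 1) (h : ∀ i j, 0 ≤ s i * s j * M i j) :
    0 ≤ M.permanent := by
  refine Finset.sum_nonneg fun σ _ => ?_
  have : ∏ i, M (σ i) i = ∏ i, (s (σ i) * s i * M (σ i) i) := by
    rw [Finset.prod_mul_distrib, Finset.prod_mul_distrib, Equiv.prod_comp σ s,
      ← Finset.prod_mul_distrib]
    simp [hs]
  rw [this]
  exact Finset.prod_nonneg fun i _ => h _ _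

/-- The star-shaped matrix with center `v`, unit diagonal entries away from `v`, entry `p` at
`(v, v)`, entries `q` in the rest of row `v`, and entries `-1` in the rest of column `v`. -/
def starMatrix {n : Type*} [DecidableEq n] (v : n) (p q : ℝ) : Matrix n n ℝ :=
  of fun b c => if b = c then (if b = v then p else 1) else
    if b = v then q else if c = v then -1 else 0

theorem permanent_starMatrix {n : Type*} [Fintype n] [DecidableEq n] (v : n) (p q : ℝ) :
    (starMatrix v p q).permanent = p - (Fintype.card n - 1) * q := by
  have he : (starMatrix v p q).submatrix (Equiv.sumCompl (· = v)) (Equiv.sumCompl (· = v)) =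
      pendantBlocks {b // ¬ b = v} (of fun _ _ => p) (⟨v, rfl⟩ : {b // b = v}) q (-1) := by
    ext (⟨i, hi⟩ | ⟨i, hi⟩) (⟨j, hj⟩ | ⟨j, hj⟩) <;>
      simp [pendantBlocks, starMatrix, one_apply, hi, hj]
    grind
  have hcard : (Fintype.card {b // ¬ b = v} : ℝ) = Fintype.card n - 1 := by
    rw [Fintype.card_subtype_compl, Fintype.card_subtype_eq,
      Nat.cast_sub (Fintype.card_pos_iff.mpr ⟨v⟩), Nat.cast_one]
  rw [← permanent_submatrix_equiv_self (Equiv.sumCompl (· = v)), he, permanent_pendantBlocks, hcard,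
    permanent_eq_elem_of_subsingleton _ ⟨v, rfl⟩, permanent_eq_elem_of_subsingleton _ ⟨v, rfl⟩]
  simp
  ring

theorem updateRow_starMatrix {n : Type*} [DecidableEq n] (v : n) (p q : ℝ) :
    (starMatrix v p q).updateRow v (Pi.single v 1) = starMatrix v 1 0 := by
  ext i j
  simp [starMatrix, updateRow_apply, Pi.single_apply]
  grind

end Matrix

open Matrix

theorem permL_eq {V : Type*} [Fintype V] [DecidableEq V] (G : SimpleGraph V) :
    permL G = (of fun i j => if i = j then (G.degree i : ℝ) else
      if G.Adj i j then -1 else 0).permanent := by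
  unfold permL
  have : ‹DecidableEq V› = fun a b => Classical.propDecidable (a = b) := Subsingleton.elim _ _
  subst this
  congr 1
  ext i j
  rcases eq_or_ne i j with rfl | h
  · simp [SimpleGraph.lapMatrix, SimpleGraph.degMatrix]
  · simp [SimpleGraph.lapMatrix, SimpleGraph.degMatrix, h]
    split_ifs <;> simp

section Degrees

variable {α β : Type*}

@[simp] theorem joinTrees_adj_inl_inl (H : SimpleGraph α) (T : SimpleGraph β) (u : α) (v : β)
    (a b : α) : (joinTrees H T u v).Adj (Sum.inl a) (Sum.inl b) ↔ H.Adj a b := by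
  simp [joinTrees]

@[simp] theorem joinTrees_adj_inl_inr (H : SimpleGraph α) (T : SimpleGraph β) (u : α) (v : β)
    (a : α) (b : β) : (joinTrees H T u v).Adj (Sum.inl a) (Sum.inr b) ↔ a = u ∧ b = v := by
  simp [joinTrees]

@[simp] theorem joinTrees_adj_inr_inl (H : SimpleGraph α) (T : SimpleGraph β) (u : α) (v : β)
    (a : α) (b : β) : (joinTrees H T u v).Adj (Sum.inr b) (Sum.inl a) ↔ a = u ∧ b = v := by
  rw [SimpleGraph.adj_comm, joinTrees_adj_inl_inr]

@[simp] theorem joinTrees_adj_inr_inr (H : SimpleGraph α) (T : SimpleGraph β) (u : α) (v : β)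
    (a b : β) : (joinTrees H T u v).Adj (Sum.inr a) (Sum.inr b) ↔ T.Adj a b := by
  simp [joinTrees]

@[simp] theorem attachPendants_adj_inl_inl (H : SimpleGraph α) (u : α) (a b : α) :
    (attachPendants β H u).Adj (Sum.inl a) (Sum.inl b) ↔ H.Adj a b := by
  simp [attachPendants]

@[simp] theorem attachPendants_adj_inl_inr (H : SimpleGraph α) (u : α) (a : α) (b : β) :
    (attachPendants β H u).Adj (Sum.inl a) (Sum.inr b) ↔ a = u := by
  simp [attachPendants]

@[simp] theorem attachPendants_adj_inr_inl (H : SimpleGraph α) (u : α) (a : α) (b : β) :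
    (attachPendants β H u).Adj (Sum.inr b) (Sum.inl a) ↔ a = u := by
  rw [SimpleGraph.adj_comm, attachPendants_adj_inl_inr]

@[simp] theorem attachPendants_adj_inr_inr (H : SimpleGraph α) (u : α) (a b : β) :
    ¬ (attachPendants β H u).Adj (Sum.inr a) (Sum.inr b) := by
  simp [attachPendants]

variable [Fintype α] [Fintype β]

theorem degree_joinTrees_inl (H : SimpleGraph α) (T : SimpleGraph β) (u : α) (v : β) (a : α) :
    ((joinTrees H T u v).degree (Sum.inl a) : ℝ) = H.degree a + if a = u then 1 else 0 := by
  rw [SimpleGraph.degree_eq_sum_if_adj, SimpleGraph.degree_eq_sum_if_adj, Fintype.sum_sum_type]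
  by_cases h : a = u <;> simp [h]

theorem degree_joinTrees_inr (H : SimpleGraph α) (T : SimpleGraph β) (u : α) (v : β) (b : β) :
    ((joinTrees H T u v).degree (Sum.inr b) : ℝ) = T.degree b + if b = v then 1 else 0 := by
  rw [SimpleGraph.degree_eq_sum_if_adj, SimpleGraph.degree_eq_sum_if_adj, Fintype.sum_sum_type,
    add_comm]
  by_cases h : b = v <;> simp [h]

theorem degree_attachPendants_inl (H : SimpleGraph α) (u a : α) :
    ((attachPendants β H u).degree (Sum.inl a) : ℝ) =
      H.degree a + if a = u then (Fintype.card β : ℝ) else 0 := by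
  rw [SimpleGraph.degree_eq_sum_if_adj, SimpleGraph.degree_eq_sum_if_adj, Fintype.sum_sum_type]
  by_cases h : a = u <;> simp [h]

theorem degree_attachPendants_inr (H : SimpleGraph α) (u : α) (b : β) :
    ((attachPendants β H u).degree (Sum.inr b) : ℝ) = 1 := by
  rw [SimpleGraph.degree_eq_sum_if_adj, Fintype.sum_sum_type]
  simp

theorem degree_star {T : SimpleGraph β} {v : β}
    (hstar : ∀ a b : β, T.Adj a b ↔ (a = v ∧ b ≠ v) ∨ (b = v ∧ a ≠ v)) (b : β) :
    (T.degree b : ℝ) = if b = v then (Fintype.card β : ℝ) - 1 else 1 := by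
  rw [SimpleGraph.degree_eq_sum_if_adj]
  by_cases h : b = v
  · simp [hstar, h, Finset.sum_ite, Finset.filter_ne', Finset.card_erase_of_mem,
      Nat.cast_sub (Fintype.card_pos_iff.mpr ⟨v⟩ : 1 ≤ Fintype.card β)]
  · simp [hstar, h]

end Degrees

section Permanents

variable {α β : Type*} [Fintype α] [Fintype β]

/-- The Laplacian matrix of `G` with its row of index `u` replaced by `x`. -/
noncomputable def lapUpdateRow (G : SimpleGraph α) (u : α) (x : α → ℝ) : Matrix α α ℝ :=
  (of fun i j => if i = j then (G.degree i : ℝ) else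
    if G.Adj i j then -1 else 0).updateRow u x

theorem updateRow_lapUpdateRow (G : SimpleGraph α) (u : α) (x y : α → ℝ) :
    (lapUpdateRow G u x).updateRow u y = lapUpdateRow G u y :=
  updateRow_idem ..

/-- The permanent of the Laplacian matrix with the diagonal entry at `u` replaced by `t`. -/
theorem permanent_lapUpdateRow_add (G : SimpleGraph α) (u : α) (t : ℝ) :
    (lapUpdateRow G u fun j => if u = j then t else if G.Adj u j then -1 else 0).permanent =
      t * (lapUpdateRow G u (Pi.single u 1)).permanent +
        (lapUpdateRow G u fun j => if G.Adj u j then -1 else 0).permanent := by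
  have : (fun j => if u = j then t else if G.Adj u j then -1 else 0) =
      t • Pi.single u (1 : ℝ) + fun j => if G.Adj u j then -1 else 0 := by
    ext j
    rcases eq_or_ne u j with rfl | h
    · simp
    · simp [h]
  rw [this, lapUpdateRow, permanent_updateRow_add, permanent_updateRow_smul]
  rfl

theorem permanent_lapUpdateRow_nonneg {G : SimpleGraph α} (hG : G.IsTree) (u : α) {x : α → ℝ}
    (hx : 0 ≤ x u) (hadj : ∀ j, G.Adj u j → x j ≤ 0) (hnadj : ∀ j, j ≠ u → ¬ G.Adj u j → x j = 0) :
    0 ≤ (lapUpdateRow G u x).permanent := by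
  obtain ⟨C⟩ := hG.colorable_two
  refine permanent_nonneg_of_signs (fun i => if C i = 0 then 1 else -1)
    (fun i => by split_ifs <;> norm_num) fun i j => ?_
  have hself (i : α) : (if C i = 0 then (1 : ℝ) else -1) * (if C i = 0 then 1 else -1) = 1 := by
    split_ifs <;> norm_num
  have hne (i j : α) (h : G.Adj i j) :
      (if C i = 0 then (1 : ℝ) else -1) * (if C j = 0 then 1 else -1) = -1 := by
    have := C.valid h
    rcases Fin.exists_fin_two.mp ⟨C i, rfl⟩ with hi | hi <;>
      rcases Fin.exists_fin_two.mp ⟨C j, rfl⟩ with hj | hj <;> simp_all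
  by_cases hi : i = u
  · subst hi
    rw [lapUpdateRow, updateRow_self]
    by_cases hj : j = i
    · subst hj
      rwa [hself, one_mul]
    by_cases h : G.Adj i j
    · rw [hne i j h]
      linarith [hadj j h]
    · rw [hnadj j hj h, mul_zero]
  · rw [lapUpdateRow, updateRow_ne hi, of_apply]
    by_cases hj : i = j
    · subst hj
      simp only [hself, if_true, one_mul]
      positivity
    by_cases h : G.Adj i j
    · simp [hne i j h, hj, h]
    · simp [hj, h]

theorem permL_attachPendants (H : SimpleGraph α) (u : α) :
    permL (attachPendants β H u) =
      (H.degree u + 2 * Fintype.card β) * (lapUpdateRow H u (Pi.single u 1)).permanent +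
        (lapUpdateRow H u fun j => if H.Adj u j then -1 else 0).permanent := by
  have hM : (of fun i j => if i = j then ((attachPendants β H u).degree i : ℝ) else
      if (attachPendants β H u).Adj i j then -1 else 0) =
      pendantBlocks β (lapUpdateRow H u fun j => if u = j then (H.degree u : ℝ) + Fintype.card β
        else if H.Adj u j then -1 else 0) u (-1) (-1) := by
    ext (i | i) (j | j) <;>
    simp [pendantBlocks, lapUpdateRow, updateRow_apply, degree_attachPendants_inl,
      degree_attachPendants_inr, one_apply]
    grind
  rw [permL_eq, hM, permanent_pendantBlocks, permanent_lapUpdateRow_add,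
    updateRow_lapUpdateRow]
  ring

theorem permL_joinTrees_star (H : SimpleGraph α) {T : SimpleGraph β} (u : α) {v : β}
    (hstar : ∀ a b : β, T.Adj a b ↔ (a = v ∧ b ≠ v) ∨ (b = v ∧ a ≠ v)) :
    permL (joinTrees H T u v) =
      (2 * Fintype.card β - 1) *
        ((H.degree u + 1) * (lapUpdateRow H u (Pi.single u 1)).permanent +
          (lapUpdateRow H u fun j => if H.Adj u j then -1 else 0).permanent) +
        (lapUpdateRow H u (Pi.single u 1)).permanent := by
  have hM : (of fun i j => if i = j then ((joinTrees H T u v).degree i : ℝ) else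
      if (joinTrees H T u v).Adj i j then -1 else 0) =
      fromBlocks (lapUpdateRow H u fun j => if u = j then (H.degree u : ℝ) + 1
        else if H.Adj u j then -1 else 0) (single u v (-1)) (single v u (-1))
        (starMatrix v (Fintype.card β) (-1)) := by
    ext (i | i) (j | j) <;>
    simp [starMatrix, lapUpdateRow, updateRow_apply, degree_joinTrees_inl,
      degree_joinTrees_inr, single_apply, degree_star hstar, hstar] <;> grind
  rw [permL_eq, hM, permanent_fromBlocks_single, permanent_lapUpdateRow_add,
    updateRow_lapUpdateRow, updateRow_starMatrix, permanent_starMatrix,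
    permanent_starMatrix]
  ring

theorem PD_attachPendants (H : SimpleGraph α) (u : α) :
    PD (attachPendants β H u) =
      (H.degree u + Fintype.card β) * ∏ a ∈ Finset.univ.erase u, (H.degree a : ℝ) := by
  simp only [PD, Fintype.prod_sum_type, degree_attachPendants_inl, degree_attachPendants_inr,
    Finset.prod_const_one, mul_one]
  rw [← Finset.mul_prod_erase _ _ (Finset.mem_univ u), if_pos rfl]
  congr 1
  exact Finset.prod_congr rfl fun a ha => by simp [Finset.ne_of_mem_erase ha]

theorem PD_joinTrees_star (H : SimpleGraph α) {T : SimpleGraph β} (u : α) {v : β}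
    (hstar : ∀ a b : β, T.Adj a b ↔ (a = v ∧ b ≠ v) ∨ (b = v ∧ a ≠ v)) :
    PD (joinTrees H T u v) =
      (H.degree u + 1) * (∏ a ∈ Finset.univ.erase u, (H.degree a : ℝ)) * Fintype.card β := by
  simp only [PD, Fintype.prod_sum_type, degree_joinTrees_inl, degree_joinTrees_inr,
    degree_star hstar]
  congr 1
  · rw [← Finset.mul_prod_erase _ _ (Finset.mem_univ u), if_pos rfl]
    congr 1
    exact Finset.prod_congr rfl fun a ha => by simp [Finset.ne_of_mem_erase ha]
  · rw [← Finset.mul_prod_erase _ _ (Finset.mem_univ v),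
      Finset.prod_eq_one fun b hb => by simp [Finset.ne_of_mem_erase hb]]
    simp

end Permanents

/-- The numerical inequality behind the comparison, cleared of the common factor `∏ deg`. -/
theorem pendant_ratio_le {a b d r : ℝ} (ha : 0 ≤ a) (hb : 0 ≤ b) (hd : 0 ≤ d) (hr : 1 ≤ r) :
    ((d + 2 * r) * a + b) / (d + r) ≤ ((2 * r - 1) * ((d + 1) * a + b) + a) / ((d + 1) * r) := by
  rw [div_le_div_iff₀ (by positivity) (by positivity)]
  have h : ((2 * r - 1) * ((d + 1) * a + b) + a) * (d + r) - ((d + 2 * r) * a + b) * ((d + 1) * r) =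
      a * (d ^ 2 * (r - 1)) + b * ((r - 1) * (d + r) + r * (r - 1)) := by ring
  have h₁ : 0 ≤ r - 1 := by linarith
  have h₂ : 0 ≤ a * (d ^ 2 * (r - 1)) + b * ((r - 1) * (d + r) + r * (r - 1)) := by positivity
  linarith

/-- if `T` is a star on `r ≥ 1` vertices with center `v`, then
`π(G₁) ≥ π(G₂)`. -/
theorem lapRatio_joinStar_ge {α β : Type*} [Fintype α] [Fintype β]
    (r : ℕ) (hr : 1 ≤ r) (hβ : Fintype.card β = r)
    (H : SimpleGraph α) (T : SimpleGraph β) (hH : H.IsTree) (hT : T.IsTree)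
    (u : α) (v : β)
    (hstar : ∀ a b : β, T.Adj a b ↔ (a = v ∧ b ≠ v) ∨ (b = v ∧ a ≠ v)) :
    lapRatio (attachPendants β H u) ≤ lapRatio (joinTrees H T u v) := by
  subst hβ
  have hr' : (1 : ℝ) ≤ Fintype.card β := by exact_mod_cast hr
  have ha : 0 ≤ (lapUpdateRow H u (Pi.single u 1)).permanent :=
    permanent_lapUpdateRow_nonneg hH u (by simp) (fun j h => by simp [h.ne'])
      fun j h _ => by simp [h]
  have hb : 0 ≤ (lapUpdateRow H u fun j => if H.Adj u j then -1 else 0).permanent :=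
    permanent_lapUpdateRow_nonneg hH u (by simp) (fun j h => by simp [h])
      fun j _ h => by simp [h]
  have hP : 0 ≤ ∏ a ∈ Finset.univ.erase u, (H.degree a : ℝ) :=
    Finset.prod_nonneg fun a _ => Nat.cast_nonneg _
  rw [lapRatio, lapRatio, permL_attachPendants, permL_joinTrees_star H u hstar,
    PD_attachPendants, PD_joinTrees_star H u hstar, mul_right_comm, ← div_div, ← div_div]
  exact div_le_div_of_nonneg_right
    (pendant_ratio_le ha hb (Nat.cast_nonneg _) hr') hP
end

section
/- Let s and t be positive integers with s ≥ t, and let T'' be a tree with n ≥ 4 vertices containing two distinct vertices u and v, each of degree 2 in T''. Let T be the tree obtained from T'' by attaching s pendant edges at u and t pendant edges at v, let T_1 be the tree obtained from T'' by attaching s+t pendant edges at u, and let T_2 be the tree obtained from T'' by attaching s+t pendant edges at v. Then π(T) > min{π(T_1), π(T_2)}. -/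
open scoped Classical

/-- The tree obtained from `H` by attaching `s` pendant edges at `u` and `t` pendant
edges at `v` (pendant `i : Fin (s+t)` goes to `u` if `i < s`, else to `v`). -/
def attachTwoPendantSets {α : Type*} (H : SimpleGraph α) (u v : α) (s t : ℕ) :
    SimpleGraph (α ⊕ Fin (s + t)) :=
  (H ⊕g (⊥ : SimpleGraph (Fin (s + t)))) ⊔
    SimpleGraph.fromEdgeSet
      {e | ∃ i : Fin (s + t), e = s(Sum.inl (if (i : ℕ) < s then u else v), Sum.inr i)}

section

open Finset Equiv

theorem permanent_option_of_pendant {ι : Type*} [Fintype ι] [DecidableEq ι]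
    (N : Matrix (Option ι) (Option ι) ℝ) (u : ι) (hnn : N none none = 1)
    (hcol : ∀ i, N (some i) none = if i = u then -1 else 0)
    (hrow : ∀ i, N none (some i) = if i = u then -1 else 0) :
    N.permanent = (N.submatrix some some + Matrix.single u u 1).permanent := by
  have hdec : N.permanent = ∑ τ : Perm ι, ∏ i, N (some (τ i)) (some i) -
      ∑ τ : Perm ι, ∏ i, N (swap none (some u) (some (τ i))) (some i) := by
    rw [Matrix.permanent, ← Equiv.sum_comp Perm.decomposeOption.symm]
    simp [Fintype.sum_prod_type, Fintype.sum_option, Fintype.prod_option,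
      Perm.decomposeOption, hnn, hcol, sub_eq_add_neg, ← mul_sum]
  rw [hdec, Matrix.permanent, ← sum_sub_distrib]
  refine sum_congr rfl fun τ _ => ?_
  by_cases hτ : τ u = u
  · have hsplit (g : ι → ℝ) : ∏ i, g i = g u * ∏ i ∈ univ.erase u, g i :=
      (mul_prod_erase univ g (mem_univ u)).symm
    simp only [hsplit]
    have h₁ : ∏ i ∈ univ.erase u, N (swap none (some u) (some (τ i))) (some i) =
        ∏ i ∈ univ.erase u, N (some (τ i)) (some i) := by
      refine prod_congr rfl fun i hi => ?_
      have : τ i ≠ u := fun h => (mem_erase.1 hi).1 (τ.injective (h.trans hτ.symm))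
      rw [swap_apply_of_ne_of_ne (by simp) (by simpa using this)]
    have h₂ : ∏ i ∈ univ.erase u, (N.submatrix some some + Matrix.single u u 1 : Matrix ι ι ℝ) (τ i) i =
        ∏ i ∈ univ.erase u, N (some (τ i)) (some i) := by
      refine prod_congr rfl fun i hi => ?_
      simp [(mem_erase.1 hi).1.symm]
    rw [h₁, h₂]
    simp [hτ, hrow]
    ring
  · have hz : ∏ i, N (swap none (some u) (some (τ i))) (some i) = 0 := by
      refine prod_eq_zero (mem_univ (τ.symm u)) ?_
      have : τ.symm u ≠ u := fun h => hτ ((τ.symm_apply_eq.1 h).symm)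
      simp [hrow, this]
    rw [hz, sub_zero]
    refine prod_congr rfl fun i _ => ?_
    have : ¬ (u = τ i ∧ u = i) := by
      rintro ⟨h, rfl⟩
      exact hτ h.symm
    simp [this]

theorem permanent_submatrix_equiv {ι κ : Type*} [Fintype ι] [DecidableEq ι] [Fintype κ]
    [DecidableEq κ] (e : ι ≃ κ) (N : Matrix κ κ ℝ) :
    (N.submatrix e e).permanent = N.permanent := by
  simp only [Matrix.permanent, Matrix.submatrix_apply]
  rw [← Equiv.sum_comp e.permCongr]
  refine sum_congr rfl fun σ _ => ?_
  rw [← Equiv.prod_comp e]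
  simp

/-- The matrix obtained from `M` by adding, for each `b : β`, a pendant row and column
joined to the index `f b`. -/
def pendantMatrix {α β : Type*} [DecidableEq α] [DecidableEq β] (M : Matrix α α ℝ) (f : β → α) :
    Matrix (α ⊕ β) (α ⊕ β) ℝ :=
  Matrix.fromBlocks M (Matrix.of fun i b => if i = f b then -1 else 0)
    (Matrix.of fun b i => if i = f b then -1 else 0) 1

/-- `α ⊕ Fin (k + 1)` with the vertex `inr 0` singled out. -/
def optionSumFinEquiv (α : Type*) (k : ℕ) : Option (α ⊕ Fin k) ≃ α ⊕ Fin (k + 1) where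
  toFun x := x.elim (Sum.inr 0) (Sum.map id Fin.succ)
  invFun := Sum.elim (some ∘ Sum.inl) (Fin.cases none (some ∘ Sum.inr))
  left_inv x := by rcases x with _ | _ | _ <;> rfl
  right_inv x := by
    rcases x with x | x
    · rfl
    · cases x using Fin.cases <;> rfl

theorem permanent_pendantMatrix {α : Type*} [Fintype α] [DecidableEq α] (k : ℕ) (M : Matrix α α ℝ)
    (f : Fin k → α) : (pendantMatrix M f).permanent =
      (M + Matrix.diagonal fun i => (#{b | f b = i} : ℝ)).permanent := by
  induction k generalizing M with
  | zero =>
    rw [← permanent_submatrix_equiv (Equiv.sumEmpty α (Fin 0)).symm]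
    congr 1
    ext i j
    simp [pendantMatrix]
  | succ k ih =>
    rw [← permanent_submatrix_equiv (optionSumFinEquiv α k),
      permanent_option_of_pendant _ (Sum.inl (f 0))]
    · have h : ((pendantMatrix M f).submatrix (optionSumFinEquiv α k)
          (optionSumFinEquiv α k)).submatrix some some +
          Matrix.single (Sum.inl (f 0)) (Sum.inl (f 0)) 1 =
          pendantMatrix (M + Matrix.single (f 0) (f 0) 1) (fun b => f b.succ) := by
        ext (i | i) (j | j) <;>
          simp [pendantMatrix, optionSumFinEquiv, Matrix.single_apply, Matrix.one_apply]
      rw [h, ih, add_assoc]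
      congr 2
      ext i j
      by_cases hij : i = j
      · subst hij
        simp [Matrix.single_apply, Fin.card_filter_univ_succ]
        split_ifs <;> simp [add_comm]
      · simp [hij, Matrix.single_apply]
        rintro rfl h
        exact hij h
    · simp [pendantMatrix, optionSumFinEquiv]
    · rintro (i | i) <;> simp [pendantMatrix, optionSumFinEquiv]
    · rintro (i | i) <;> simp [pendantMatrix, optionSumFinEquiv, Matrix.one_apply]
      exact (Fin.succ_ne_zero i).symm

/-- The graph obtained from `H` by attaching, for every `b`, a pendant edge at `f b`. -/
def attachAt {α β : Type*} (H : SimpleGraph α) (f : β → α) : SimpleGraph (α ⊕ β) :=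
  (H ⊕g (⊥ : SimpleGraph β)) ⊔
    SimpleGraph.fromEdgeSet {e | ∃ b : β, e = s(Sum.inl (f b), Sum.inr b)}

section attachAt

variable {α β : Type*} (H : SimpleGraph α) (f : β → α)

theorem attachAt_adj_inl_inl (i j : α) :
    (attachAt H f).Adj (Sum.inl i) (Sum.inl j) ↔ H.Adj i j := by
  simp [attachAt]

theorem attachAt_adj_inl_inr (i : α) (b : β) :
    (attachAt H f).Adj (Sum.inl i) (Sum.inr b) ↔ i = f b := by
  simp [attachAt]

theorem attachAt_adj_inr_inl (b : β) (i : α) :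
    (attachAt H f).Adj (Sum.inr b) (Sum.inl i) ↔ i = f b := by
  rw [SimpleGraph.adj_comm, attachAt_adj_inl_inr]

theorem attachAt_not_adj_inr_inr (b c : β) :
    ¬ (attachAt H f).Adj (Sum.inr b) (Sum.inr c) := by
  simp [attachAt]

variable [Fintype α] [Fintype β]

theorem degree_attachAt_inl (i : α) :
    ((attachAt H f).degree (Sum.inl i) : ℝ) = H.degree i + #{b | f b = i} := by
  rw [SimpleGraph.degree_eq_sum_if_adj, SimpleGraph.degree_eq_sum_if_adj, Fintype.sum_sum_type]
  simp only [attachAt_adj_inl_inl, attachAt_adj_inl_inr, sum_boole, eq_comm]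

theorem degree_attachAt_inr (b : β) : ((attachAt H f).degree (Sum.inr b) : ℝ) = 1 := by
  rw [SimpleGraph.degree_eq_sum_if_adj, Fintype.sum_sum_type]
  simp [attachAt_adj_inr_inl, attachAt_not_adj_inr_inr]

theorem lapMatrix_attachAt : (attachAt H f).lapMatrix ℝ =
    pendantMatrix (H.lapMatrix ℝ + Matrix.diagonal fun i => (#{b | f b = i} : ℝ)) f := by
  ext (i | i) (j | j)
  · by_cases hij : i = j
    · subst hij
      simp [SimpleGraph.lapMatrix, SimpleGraph.degMatrix, pendantMatrix, degree_attachAt_inl]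
    · simp [SimpleGraph.lapMatrix, SimpleGraph.degMatrix, pendantMatrix, attachAt_adj_inl_inl, hij]
  · simp [SimpleGraph.lapMatrix, SimpleGraph.degMatrix, pendantMatrix, attachAt_adj_inl_inr,
      apply_ite]
  · simp [SimpleGraph.lapMatrix, SimpleGraph.degMatrix, pendantMatrix, attachAt_adj_inr_inl,
      apply_ite]
  · simp [SimpleGraph.lapMatrix, SimpleGraph.degMatrix, pendantMatrix, attachAt_not_adj_inr_inr,
      Matrix.diagonal_apply, Matrix.one_apply, degree_attachAt_inr]

end attachAt

theorem permL_attachAt {α : Type*} [Fintype α] (H : SimpleGraph α) {k : ℕ} (f : Fin k → α) :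
    permL (attachAt H f) =
      (H.lapMatrix ℝ + Matrix.diagonal fun i => 2 * (#{b | f b = i} : ℝ)).permanent := by
  have h : permL (attachAt H f) = (pendantMatrix
      (H.lapMatrix ℝ + Matrix.diagonal fun i => (#{b | f b = i} : ℝ)) f).permanent := by
    rw [permL]
    convert congrArg Matrix.permanent (lapMatrix_attachAt H f)
  rw [h, permanent_pendantMatrix, add_assoc, Matrix.diagonal_add]
  simp only [two_mul]

theorem PD_attachAt {α β : Type*} [Fintype α] [Fintype β] (H : SimpleGraph α) (f : β → α) :
    PD (attachAt H f) = ∏ i, ((H.degree i : ℝ) + #{b | f b = i}) := by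
  simp [PD, Fintype.prod_sum_type, degree_attachAt_inl, degree_attachAt_inr]

/-- In an acyclic graph, a permutation moving vertices only along edges is an involution. -/
theorem SimpleGraph.IsAcyclic.perm_apply_apply {α : Type*} [Finite α] {H : SimpleGraph α}
    (hH : H.IsAcyclic) {σ : Perm α} (hσ : ∀ i, σ i = i ∨ H.Adj i (σ i)) (i : α) :
    σ (σ i) = i := by
  rcases hσ i with h | h
  · rw [h, h]
  by_contra hne
  have hbr := SimpleGraph.isBridge_iff.1 (SimpleGraph.isAcyclic_iff_forall_adj_isBridge.1 hH h)
  have hreach : ∀ j : ℕ, (H.deleteEdges {s(i, σ i)}).Reachable (σ i) ((σ ^ (j + 1)) i) := by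
    intro j
    induction j with
    | zero => simp
    | succ j ih =>
      rw [pow_succ' σ (j + 1), Perm.mul_apply]
      set x := (σ ^ (j + 1)) i
      by_cases hx : x = i
      · rw [hx]
      rcases hσ x with hfix | hadj
      · rwa [hfix]
      refine ih.trans (SimpleGraph.Adj.reachable ?_)
      rw [SimpleGraph.deleteEdges_adj]
      refine ⟨hadj, ?_⟩
      rw [Set.mem_singleton_iff, Sym2.eq_iff]
      rintro (⟨h₁, -⟩ | ⟨h₁, h₂⟩)
      · exact hx h₁
      · exact hne (h₁ ▸ h₂)
  have h := hreach (orderOf σ - 1)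
  rw [Nat.sub_add_cancel (orderOf_pos σ), pow_orderOf_eq_one] at h
  exact hbr h.symm

section EdgePerms

variable {α : Type*} [Fintype α] (H : SimpleGraph α)

/-- The permutations moving vertices only along edges of `H`; when `H` is acyclic these
correspond to its matchings. -/
noncomputable def edgePerms : Finset (Perm α) :=
  {σ | ∀ i, σ i = i ∨ H.Adj i (σ i)}

/-- The product of the degrees of the vertices other than `u`, `v` that are fixed by `σ`. -/
noncomputable def fixedWeight (u v : α) (σ : Perm α) : ℝ :=
  ∏ i ∈ ({u, v} : Finset α)ᶜ, if σ i = i then (H.degree i : ℝ) else 1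

/-- The sum of `fixedWeight` over the permutations along edges that satisfy `p`. -/
noncomputable def weightSum (u v : α) (p : Perm α → Prop) : ℝ :=
  ∑ σ ∈ edgePerms H with p σ, fixedWeight H u v σ

variable {H} {u v : α}

theorem mem_edgePerms {σ : Perm α} : σ ∈ edgePerms H ↔ ∀ i, σ i = i ∨ H.Adj i (σ i) := by
  simp [edgePerms]

theorem weightSum_eq_sum_filter (p : Perm α → Prop) [DecidablePred p] :
    weightSum H u v p = ∑ σ ∈ edgePerms H with p σ, fixedWeight H u v σ := by
  unfold weightSum
  congr!

theorem weightSum_comm (p : Perm α → Prop) : weightSum H u v p = weightSum H v u p := by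
  simp only [weightSum, fixedWeight, pair_comm]

theorem fixedWeight_nonneg (σ : Perm α) : 0 ≤ fixedWeight H u v σ :=
  prod_nonneg fun i _ => by split_ifs <;> positivity

theorem weightSum_nonneg (p : Perm α → Prop) : 0 ≤ weightSum H u v p :=
  sum_nonneg fun σ _ => fixedWeight_nonneg σ

theorem permanent_lapMatrix_add_diagonal (hH : H.IsAcyclic) (c : α → ℝ) :
    (H.lapMatrix ℝ + Matrix.diagonal c).permanent =
      ∑ σ ∈ edgePerms H, ∏ i, if σ i = i then H.degree i + c i else 1 := by
  rw [Matrix.permanent, ← sum_subset (subset_univ (edgePerms H))]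
  · refine sum_congr rfl fun σ hσ => ?_
    have hinv := hH.perm_apply_apply (mem_edgePerms.1 hσ)
    have hentry (i : α) : (H.lapMatrix ℝ + Matrix.diagonal c) (σ i) i =
        (if σ i = i then H.degree i + c i else 1) * if σ i = i then 1 else -1 := by
      by_cases h : σ i = i
      · simp [h, SimpleGraph.lapMatrix, SimpleGraph.degMatrix]
      · have hadj := ((mem_edgePerms.1 hσ i).resolve_left h).symm
        simp [h, hadj, SimpleGraph.lapMatrix, SimpleGraph.degMatrix]
    simp only [hentry, prod_mul_distrib]
    rw [prod_involution (f := fun i => if σ i = i then (1 : ℝ) else -1) (fun i _ => σ i), mul_one]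
    · intro i _
      by_cases h : σ i = i
      · simp [h]
      · simp [h, hinv, Ne.symm h]
    · intro i _ h h'
      simp [h'] at h
    · simp
    · simp [hinv]
  · intro σ _ hσ
    rw [mem_edgePerms] at hσ
    push Not at hσ
    obtain ⟨i, hi, hadj⟩ := hσ
    refine prod_eq_zero (mem_univ i) ?_
    simp [hi, mt SimpleGraph.Adj.symm hadj, SimpleGraph.lapMatrix, SimpleGraph.degMatrix]

theorem permanent_lapMatrix_add_diagonal_eq_weightSum (hH : H.IsAcyclic) (huv : u ≠ v)
    (c : α → ℝ) (hc : ∀ i, i ≠ u → i ≠ v → c i = 0) :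
    (H.lapMatrix ℝ + Matrix.diagonal c).permanent =
      (H.degree u + c u) * (H.degree v + c v) * weightSum H u v (fun σ => σ u = u ∧ σ v = v) +
      (H.degree u + c u) * weightSum H u v (fun σ => σ u = u ∧ σ v ≠ v) +
      (H.degree v + c v) * weightSum H u v (fun σ => σ u ≠ u ∧ σ v = v) +
      weightSum H u v (fun σ => σ u ≠ u ∧ σ v ≠ v) := by
  rw [permanent_lapMatrix_add_diagonal hH]
  simp only [weightSum, sum_filter, mul_sum, ← sum_add_distrib]
  refine sum_congr rfl fun σ _ => ?_
  rw [← prod_mul_prod_compl {u, v}, prod_pair huv]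
  have h : ∏ i ∈ ({u, v} : Finset α)ᶜ, (if σ i = i then H.degree i + c i else 1) =
      fixedWeight H u v σ := by
    refine prod_congr rfl fun i hi => ?_
    simp only [mem_compl, mem_insert, mem_singleton, not_or] at hi
    rw [hc i hi.1 hi.2, add_zero]
  rw [h]
  by_cases h₁ : σ u = u <;> by_cases h₂ : σ v = v <;> simp [h₁, h₂]

/-- Undoing the transpositions at `u` and `v` injects the permutations with prescribed values
there into those fixing `u` and `v`. -/
theorem mul_weightSum_le (hH : H.IsAcyclic) {w w' : α} {r : ℝ}
    (hr : ∀ σ τ : Perm α, σ u = w → σ v = w' → σ w = u →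
      (∀ i, τ i = if i = u ∨ i = v ∨ i = w ∨ i = w' then i else σ i) →
      r * fixedWeight H u v σ ≤ fixedWeight H u v τ) :
    r * weightSum H u v (fun σ => σ u = w ∧ σ v = w') ≤
      weightSum H u v (fun σ => σ u = u ∧ σ v = v) := by
  have hex : ∀ σ : Perm α, σ ∈ (edgePerms H).filter (fun σ => σ u = w ∧ σ v = w') →
      ∃ τ : Perm α, ∀ i, τ i = if i = u ∨ i = v ∨ i = w ∨ i = w' then i else σ i := by
    intro σ hσ
    obtain ⟨hmem, rfl, rfl⟩ := mem_filter.1 hσ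
    have hinv := hH.perm_apply_apply (mem_edgePerms.1 hmem)
    refine ⟨Function.Involutive.toPerm
      (fun i => if i = u ∨ i = v ∨ i = σ u ∨ i = σ v then i else σ i) fun i => ?_, fun i => rfl⟩
    grind
  choose! Φ hΦ using hex
  have hinj : Set.InjOn Φ ((edgePerms H).filter (fun σ => σ u = w ∧ σ v = w')) := by
    intro σ hσ τ hτ h
    have h₁ := hΦ σ hσ
    have h₂ := hΦ τ hτ
    obtain ⟨hσ, hσu, hσv⟩ := mem_filter.1 hσ
    obtain ⟨hτ, hτu, hτv⟩ := mem_filter.1 hτ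
    have hinvσ := hH.perm_apply_apply (mem_edgePerms.1 hσ)
    have hinvτ := hH.perm_apply_apply (mem_edgePerms.1 hτ)
    ext i
    have h₁ := h₁ i
    have h₂ := h₂ i
    rw [h] at h₁
    grind
  have hle := calc
    ∑ σ ∈ edgePerms H with σ u = w ∧ σ v = w', r * fixedWeight H u v σ ≤
        ∑ σ ∈ edgePerms H with σ u = w ∧ σ v = w', fixedWeight H u v (Φ σ) := by
        refine sum_le_sum fun σ hσ => ?_
        have hΦσ := hΦ σ hσ
        obtain ⟨hσ, hσu, hσv⟩ := mem_filter.1 hσ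
        exact hr σ _ hσu hσv (hσu ▸ hH.perm_apply_apply (mem_edgePerms.1 hσ) u) hΦσ
    _ = ∑ τ ∈ ((edgePerms H).filter (fun σ => σ u = w ∧ σ v = w')).image Φ,
          fixedWeight H u v τ := (sum_image hinj).symm
    _ ≤ ∑ σ ∈ edgePerms H with σ u = u ∧ σ v = v, fixedWeight H u v σ := by
        refine sum_le_sum_of_subset_of_nonneg ?_ fun τ _ _ => fixedWeight_nonneg τ
        intro τ hτ
        obtain ⟨σ, hσ, rfl⟩ := mem_image.1 hτ
        have hΦσ := hΦ σ hσ
        have hσ := mem_edgePerms.1 (mem_filter.1 hσ).1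
        rw [mem_filter, mem_edgePerms]
        refine ⟨fun i => ?_, by simp [hΦσ], by simp [hΦσ]⟩
        rw [hΦσ]
        split_ifs
        · exact Or.inl rfl
        · exact hσ i
  rwa [weightSum_eq_sum_filter, weightSum_eq_sum_filter, mul_sum]

theorem weightSum_apply_eq_le (hH : H.IsAcyclic) (hdeg : ∀ i, 1 ≤ H.degree i) (w w' : α) :
    weightSum H u v (fun σ => σ u = w ∧ σ v = w') ≤
      weightSum H u v (fun σ => σ u = u ∧ σ v = v) := by
  rw [← one_mul (weightSum H u v fun σ => σ u = w ∧ σ v = w')]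
  refine mul_weightSum_le hH fun σ τ _ _ _ hτ => ?_
  rw [one_mul]
  refine prod_le_prod (fun i _ => by split_ifs <;> positivity) fun i _ => ?_
  have hd : (1 : ℝ) ≤ H.degree i := by exact_mod_cast hdeg i
  rw [hτ i]
  split_ifs <;> simp_all

theorem two_mul_weightSum_apply_eq_le (hH : H.IsAcyclic) (hdeg : ∀ i, 1 ≤ H.degree i)
    {w : α} (hwu : w ≠ u) (hw : w = v ∨ 2 ≤ H.degree w) :
    2 * weightSum H u v (fun σ => σ u = w ∧ σ v = v) ≤
      weightSum H u v (fun σ => σ u = u ∧ σ v = v) := by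
  refine mul_weightSum_le hH fun σ τ hσu hσv hσw hτ => ?_
  have hwv : w ≠ v := by
    rintro rfl
    exact hwu (hσv.symm.trans hσw)
  have hw2 : (2 : ℝ) ≤ H.degree w := by exact_mod_cast hw.resolve_left hwv
  have hmem : w ∈ ({u, v} : Finset α)ᶜ := by simp [hwu, hwv]
  rw [fixedWeight, fixedWeight, ← mul_prod_erase _ _ hmem, ← mul_prod_erase _ _ hmem, hσw,
    if_neg hwu.symm, one_mul, hτ w]
  refine mul_le_mul (by simpa using hw2) ?_ (prod_nonneg fun i _ => by split_ifs <;> positivity)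
    (by split_ifs <;> positivity)
  refine prod_le_prod (fun i _ => by split_ifs <;> positivity) fun i _ => ?_
  have hd : (1 : ℝ) ≤ H.degree i := by exact_mod_cast hdeg i
  rw [hτ i]
  split_ifs <;> simp_all

theorem weightSum_fixed_pos (hdeg : ∀ i, 1 ≤ H.degree i) :
    0 < weightSum H u v (fun σ => σ u = u ∧ σ v = v) := by
  refine sum_pos' (fun σ _ => fixedWeight_nonneg σ) ⟨1, by simp [mem_edgePerms], ?_⟩
  refine prod_pos fun i _ => ?_
  have := hdeg i
  simp only [Perm.one_apply, if_true]
  positivity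

theorem weightSum_move_left_le (hH : H.IsAcyclic) (hdeg : ∀ i, 1 ≤ H.degree i)
    (hu : H.degree u = 2) {w : α} (huw : H.Adj u w) (hw : w = v ∨ 2 ≤ H.degree w) :
    2 * weightSum H u v (fun σ => σ u ≠ u ∧ σ v = v) ≤
      3 * weightSum H u v (fun σ => σ u = u ∧ σ v = v) := by
  have hfib : weightSum H u v (fun σ => σ u ≠ u ∧ σ v = v) =
      ∑ x ∈ H.neighborFinset u, weightSum H u v (fun σ => σ u = x ∧ σ v = v) := by
    rw [weightSum_eq_sum_filter, ← sum_fiberwise_of_maps_to (t := H.neighborFinset u) (g := fun σ => σ u)]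
    · refine sum_congr rfl fun x hx => ?_
      rw [weightSum_eq_sum_filter, filter_filter]
      refine sum_congr (Finset.ext fun σ => ?_) fun _ _ => rfl
      simp only [mem_filter]
      have := ((H.mem_neighborFinset u x).1 hx).ne
      grind
    · intro σ hσ
      rw [mem_filter] at hσ
      obtain ⟨hσ, hne, -⟩ := hσ
      exact (H.mem_neighborFinset u _).2 ((mem_edgePerms.1 hσ u).resolve_left hne)
  have hmem : w ∈ H.neighborFinset u := (H.mem_neighborFinset u w).2 huw
  have hcard : #((H.neighborFinset u).erase w) = 1 := by
    rw [card_erase_of_mem hmem, SimpleGraph.card_neighborFinset_eq_degree, hu]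
  have hrest := sum_le_card_nsmul ((H.neighborFinset u).erase w)
    (fun x => weightSum H u v (fun σ => σ u = x ∧ σ v = v)) _
    fun x _ => weightSum_apply_eq_le hH hdeg x v
  have hspecial := two_mul_weightSum_apply_eq_le (u := u) hH hdeg huw.ne' hw
  rw [hcard, one_smul] at hrest
  rw [hfib, ← add_sum_erase _ _ hmem]
  linarith

theorem weightSum_move_both_le (hH : H.IsAcyclic) (hdeg : ∀ i, 1 ≤ H.degree i)
    (hu : H.degree u = 2) (hv : H.degree v = 2) :
    weightSum H u v (fun σ => σ u ≠ u ∧ σ v ≠ v) ≤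
      4 * weightSum H u v (fun σ => σ u = u ∧ σ v = v) := by
  have hfib : weightSum H u v (fun σ => σ u ≠ u ∧ σ v ≠ v) =
      ∑ x ∈ H.neighborFinset u ×ˢ H.neighborFinset v,
        weightSum H u v (fun σ => σ u = x.1 ∧ σ v = x.2) := by
    rw [weightSum_eq_sum_filter, ← sum_fiberwise_of_maps_to (t := H.neighborFinset u ×ˢ H.neighborFinset v)
      (g := fun σ => (σ u, σ v))]
    · refine sum_congr rfl fun x hx => ?_
      rw [weightSum_eq_sum_filter, filter_filter]
      refine sum_congr (Finset.ext fun σ => ?_) fun _ _ => rfl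
      simp only [mem_filter]
      rw [mem_product, H.mem_neighborFinset, H.mem_neighborFinset] at hx
      have h₁ := hx.1.ne
      have h₂ := hx.2.ne
      grind
    · intro σ hσ
      rw [mem_filter] at hσ
      obtain ⟨hσ, hne, hne'⟩ := hσ
      rw [mem_product, H.mem_neighborFinset, H.mem_neighborFinset]
      exact ⟨(mem_edgePerms.1 hσ u).resolve_left hne, (mem_edgePerms.1 hσ v).resolve_left hne'⟩
  have h := sum_le_card_nsmul (H.neighborFinset u ×ˢ H.neighborFinset v)
    (fun x => weightSum H u v (fun σ => σ u = x.1 ∧ σ v = x.2)) _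
    fun x _ => weightSum_apply_eq_le hH hdeg x.1 x.2
  rw [card_product, SimpleGraph.card_neighborFinset_eq_degree,
    SimpleGraph.card_neighborFinset_eq_degree, hu, hv, nsmul_eq_mul] at h
  rw [hfib]
  norm_num at h
  exact h

theorem exists_adj_eq_or_two_le_degree (hH : H.Connected) (huv : u ≠ v) :
    ∃ w, H.Adj u w ∧ (w = v ∨ 2 ≤ H.degree w) := by
  obtain ⟨p, hp⟩ := (hH.preconnected u v).exists_isPath
  cases p with
  | nil => exact absurd rfl huv
  | @cons _ w _ huw q =>
    refine ⟨w, huw, ?_⟩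
    cases q with
    | nil => exact Or.inl rfl
    | @cons _ x _ hwx q =>
      right
      rw [← SimpleGraph.card_neighborFinset_eq_degree]
      refine one_lt_card.2 ⟨u, (H.mem_neighborFinset w u).2 huw.symm, x,
        (H.mem_neighborFinset w x).2 hwx, ?_⟩
      rintro rfl
      simp at hp

end EdgePerms

theorem lapRatio_attachAt {α : Type*} [Fintype α] {H : SimpleGraph α} (hH : H.IsAcyclic) {u v : α}
    (huv : u ≠ v) (hu : H.degree u = 2) (hv : H.degree v = 2) {k : ℕ} (f : Fin k → α)
    (hf : ∀ b, f b = u ∨ f b = v) {a b : ℝ} (ha : #{i | f i = u} = a) (hb : #{i | f i = v} = b) :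
    lapRatio (attachAt H f) =
      ((2 + 2 * a) * (2 + 2 * b) * weightSum H u v (fun σ => σ u = u ∧ σ v = v) +
        (2 + 2 * a) * weightSum H u v (fun σ => σ u = u ∧ σ v ≠ v) +
        (2 + 2 * b) * weightSum H u v (fun σ => σ u ≠ u ∧ σ v = v) +
        weightSum H u v (fun σ => σ u ≠ u ∧ σ v ≠ v)) /
      ((2 + a) * (2 + b)) / ∏ i ∈ ({u, v} : Finset α)ᶜ, (H.degree i : ℝ) := by
  have hzero (i : α) (hiu : i ≠ u) (hiv : i ≠ v) : (#{b | f b = i} : ℝ) = 0 := by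
    rw [Nat.cast_eq_zero, card_eq_zero, filter_eq_empty_iff]
    rintro b - rfl
    exact (hf b).elim hiu hiv
  rw [lapRatio, permL_attachAt, permanent_lapMatrix_add_diagonal_eq_weightSum hH huv _
    fun i hiu hiv => by rw [hzero i hiu hiv, mul_zero], PD_attachAt,
    ← prod_mul_prod_compl {u, v}, prod_pair huv, ha, hb, hu, hv, div_div]
  congr 2
  refine prod_congr rfl fun i hi => ?_
  simp only [mem_compl, mem_insert, mem_singleton, not_or] at hi
  rw [hzero i hi.1 hi.2, add_zero]

/-- The comparison of Laplacian ratios, as a fact about the four matching sums. -/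
theorem ratio_concentrated_lt_of_le {A B B' C s t : ℝ} (hA : 0 < A) (hB : 2 * B ≤ 3 * A)
    (hBB : B' ≤ B) (hC : C ≤ 4 * A) (hs : 0 < s) (ht : 0 < t) :
    ((2 + 2 * (s + t)) * (2 + 2 * 0) * A + (2 + 2 * (s + t)) * B' + (2 + 2 * 0) * B + C) /
        ((2 + (s + t)) * (2 + 0)) <
      ((2 + 2 * s) * (2 + 2 * t) * A + (2 + 2 * s) * B' + (2 + 2 * t) * B + C) /
        ((2 + s) * (2 + t)) := by
  have hE : 0 < s * (4 * A - C) + ((s + 2) * (s + t + 2) - s) * (2 * B - 2 * B') +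
      (s * s + s * t + 2 * s) * (4 * A - 2 * B) := by
    have h₁ : 0 ≤ s * (4 * A - C) := mul_nonneg hs.le (by linarith)
    have h₂ : 0 ≤ ((s + 2) * (s + t + 2) - s) * (2 * B - 2 * B') :=
      mul_nonneg (by nlinarith) (by linarith)
    have h₃ : 0 < (s * s + s * t + 2 * s) * (4 * A - 2 * B) := mul_pos (by positivity) (by linarith)
    linarith
  rw [← sub_pos]
  have : ((2 + 2 * s) * (2 + 2 * t) * A + (2 + 2 * s) * B' + (2 + 2 * t) * B + C) /
        ((2 + s) * (2 + t)) -
      ((2 + 2 * (s + t)) * (2 + 2 * 0) * A + (2 + 2 * (s + t)) * B' + (2 + 2 * 0) * B + C) /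
        ((2 + (s + t)) * (2 + 0)) =
      t * (s * (4 * A - C) + ((s + 2) * (s + t + 2) - s) * (2 * B - 2 * B') +
        (s * s + s * t + 2 * s) * (4 * A - 2 * B)) / (2 * (2 + s) * (2 + t) * (2 + (s + t))) := by
    field_simp
    ring
  rw [this]
  positivity

theorem min_ratio_concentrated_lt {A B B' C s t : ℝ} (hA : 0 < A) (hB : 2 * B ≤ 3 * A)
    (hB' : 2 * B' ≤ 3 * A) (hC : C ≤ 4 * A) (hs : 0 < s) (ht : 0 < t) :
    min (((2 + 2 * (s + t)) * (2 + 2 * 0) * A + (2 + 2 * (s + t)) * B' + (2 + 2 * 0) * B + C) /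
        ((2 + (s + t)) * (2 + 0)))
      (((2 + 2 * 0) * (2 + 2 * (s + t)) * A + (2 + 2 * 0) * B' + (2 + 2 * (s + t)) * B + C) /
        ((2 + 0) * (2 + (s + t)))) <
      ((2 + 2 * s) * (2 + 2 * t) * A + (2 + 2 * s) * B' + (2 + 2 * t) * B + C) /
        ((2 + s) * (2 + t)) := by
  rcases le_total B' B with h | h
  · exact min_lt_of_left_lt (ratio_concentrated_lt_of_le hA hB h hC hs ht)
  · refine min_lt_of_right_lt ?_
    convert ratio_concentrated_lt_of_le hA hB' h hC ht hs using 1 <;>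
      congr 1 <;> ring

theorem card_filter_ite_lt_eq {α : Type*} {u v : α} (huv : u ≠ v) (s t : ℕ) :
    #{i : Fin (s + t) | (if (i : ℕ) < s then u else v) = u} = s ∧
      #{i : Fin (s + t) | (if (i : ℕ) < s then u else v) = v} = t := by
  simp only [card_filter, Fin.sum_univ_add]
  simp [huv, huv.symm]

end

/-- attaching `s` pendants at `u` and `t` pendants at `v` (both of degree 2
in the tree `T''` on `n ≥ 4` vertices, `s ≥ t ≥ 1`) gives a strictly larger Laplacian ratio
than the minimum of attaching all `s + t` pendants at `u` or all at `v`. -/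
theorem lapRatio_attachTwo_gt_min {α : Type*} [Fintype α] (n s t : ℕ)
    (hst : t ≤ s) (ht : 1 ≤ t) (H : SimpleGraph α) (hH : H.IsTree)
    (hn : Fintype.card α = n) (h4 : 4 ≤ n) (u v : α) (huv : u ≠ v)
    (hu : H.degree u = 2) (hv : H.degree v = 2) :
    min (lapRatio (attachPendants (Fin (s + t)) H u))
        (lapRatio (attachPendants (Fin (s + t)) H v))
      < lapRatio (attachTwoPendantSets H u v s t) := by
  have hac := hH.isAcyclic
  have : Nontrivial α := ⟨u, v, huv⟩
  have hdeg (i : α) : 1 ≤ H.degree i := hH.connected.preconnected.degree_pos_of_nontrivial i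
  obtain ⟨w, huw, hw⟩ := exists_adj_eq_or_two_le_degree hH.connected huv
  obtain ⟨x, hvx, hx⟩ := exists_adj_eq_or_two_le_degree hH.connected huv.symm
  have hB := weightSum_move_left_le hac hdeg hu huw hw
  have hB' := weightSum_move_left_le hac hdeg hv hvx hx
  simp only [weightSum_comm (u := v) (v := u), and_comm (b := _ = u)] at hB'
  have hD : 0 < ∏ i ∈ ({u, v} : Finset α)ᶜ, (H.degree i : ℝ) :=
    Finset.prod_pos fun i _ => by exact_mod_cast hdeg i
  have hcard := card_filter_ite_lt_eq huv s t
  have hT := lapRatio_attachAt hac huv hu hv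
    (fun i : Fin (s + t) => if (i : ℕ) < s then u else v) (fun i => by split_ifs <;> simp)
    (congrArg Nat.cast hcard.1) (congrArg Nat.cast hcard.2)
  have hT₁ := lapRatio_attachAt hac huv hu hv (fun _ : Fin (s + t) => u) (by simp)
    (a := s + t) (b := 0) (by simp) (by simp [huv])
  have hT₂ := lapRatio_attachAt hac huv hu hv (fun _ : Fin (s + t) => v) (by simp)
    (a := 0) (b := s + t) (by simp [huv.symm]) (by simp)
  change min (lapRatio (attachAt H fun _ : Fin (s + t) => u))
    (lapRatio (attachAt H fun _ : Fin (s + t) => v)) <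
      lapRatio (attachAt H fun i : Fin (s + t) => if (i : ℕ) < s then u else v)
  rw [hT, hT₁, hT₂, min_div_div_right hD.le]
  refine div_lt_div_of_pos_right ?_ hD
  exact min_ratio_concentrated_lt (weightSum_fixed_pos hdeg) hB hB'
    (weightSum_move_both_le hac hdeg hu hv) (by exact_mod_cast ht.trans hst) (by exact_mod_cast ht)
end
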